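/- arXiv:1210.6853 — 3 statements merged into one kernel-verified Lean document; each statement's English description precedes it below -/
import Mathlib

section
/- For every integer d ≥ 2 there exists a constant C > 0 depending only on d with the following property. Let E be a finite-dimensional real inner product space, Z ⊆ E a nonempty convex compact set, and for each 2 ≤ k ≤ d let Q_k be a symmetric k-linear form on E. Set Ẑ = conv({0} ∪ Z), φ̂(z) = Σ_{k=2}^d Q_k(z,…,z), and V = sup_{z∈Ẑ} φ̂(z) − inf_{z∈Ẑ} φ̂(z). Then for every 2 ≤ k ≤ d and all z¹,…,z^k in the linear span of Ẑ, |Q_k(z¹,…,z^k)| ≤ C·V·∏_{i=1}^k ‖z^i‖_Ẑ. -/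
open Pointwise

/-- A real polynomial of degree at most `d` has coefficients bounded by a multiple of its
supremum on `[0, 1]`, the multiple depending only on `d`. -/
theorem exists_coeff_bound (d : ℕ) :
    ∃ C : ℝ, 0 < C ∧ ∀ (a : Fin (d + 1) → ℝ) (V : ℝ),
      (∀ t ∈ Set.Icc (0 : ℝ) 1, |∑ k, a k * t ^ (k : ℕ)| ≤ V) → ∀ k, |a k| ≤ C * V := by
  set x : Fin (d + 1) → ℝ := fun i => (i : ℕ) / ((d : ℝ) + 1) with hx
  have hd : (0 : ℝ) < d + 1 := by positivity
  have hxinj : Function.Injective x := by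
    intro i j hij
    have h := (div_left_inj' hd.ne').1 hij
    exact Fin.ext (by exact_mod_cast h)
  set M := Matrix.vandermonde x
  have hM : IsUnit M.det := (Matrix.det_vandermonde_ne_zero_iff.2 hxinj).isUnit
  refine ⟨1 + ∑ k, ∑ i, |M⁻¹ k i|, by positivity, fun a V h k => ?_⟩
  have hb : ∀ i, |(M.mulVec a) i| ≤ V := by
    intro i
    have hi : x i ∈ Set.Icc (0 : ℝ) 1 := by
      refine ⟨by positivity, (div_le_one hd).2 ?_⟩
      exact_mod_cast i.2.le
    simpa [M, Matrix.mulVec, dotProduct, Matrix.vandermonde_apply, mul_comm] using h _ hi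
  have hV : 0 ≤ V := (abs_nonneg _).trans (hb 0)
  have ha : a = M⁻¹.mulVec (M.mulVec a) := by
    rw [Matrix.mulVec_mulVec, Matrix.nonsing_inv_mul _ hM, Matrix.one_mulVec]
  calc |a k| = |∑ i, M⁻¹ k i * (M.mulVec a) i| := by
        conv_lhs => rw [ha]
        rfl
    _ ≤ ∑ i, |M⁻¹ k i| * V := by
        refine (Finset.abs_sum_le_sum_abs _ _).trans (Finset.sum_le_sum fun i _ => ?_)
        rw [abs_mul]
        exact mul_le_mul_of_nonneg_left (hb i) (abs_nonneg _)
    _ = (∑ i, |M⁻¹ k i|) * V := by rw [Finset.sum_mul]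
    _ ≤ (1 + ∑ k, ∑ i, |M⁻¹ k i|) * V := by
        refine mul_le_mul_of_nonneg_right ?_ hV
        have := Finset.single_le_sum (f := fun k => ∑ i, |M⁻¹ k i|)
          (fun _ _ => by positivity) (Finset.mem_univ k)
        linarith

theorem sum_neg_one_pow_card_mul_prod_indicator {ι : Type*} [Fintype ι] [DecidableEq ι]
    (f : ι → ι) :
    ∑ S : Finset ι, (-1 : ℝ) ^ S.card * ∏ i, (if f i ∈ S then (1 : ℝ) else 0) =
      if Function.Surjective f then (-1) ^ Fintype.card ι else 0 := by
  have hprod : ∀ S : Finset ι, ∏ i, (if f i ∈ S then (1 : ℝ) else 0) =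
      if ∀ i, f i ∈ S then 1 else 0 := fun S => by simp [Finset.prod_ite_zero]
  simp only [hprod]
  split_ifs with hf
  · rw [Finset.sum_eq_single Finset.univ]
    · simp
    · intro S _ hS
      rw [if_neg, mul_zero]
      exact fun h => hS (Finset.eq_univ_iff_forall.2 (hf.forall.2 h))
    · simp
  · simp only [Function.Surjective, not_forall, not_exists] at hf
    obtain ⟨j, hj⟩ := hf
    refine Finset.sum_involution (fun S _ => if j ∈ S then S.erase j else insert j S)
      ?_ ?_ (fun _ _ => Finset.mem_univ _) ?_
    · intro S _
      by_cases hS : j ∈ S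
      · have hc : S.card = (S.erase j).card + 1 := (Finset.card_erase_add_one hS).symm
        simp only [hS, if_true, Finset.mem_erase, hj, ne_eq, not_false_eq_true, true_and, hc,
          pow_succ]
        ring
      · simp only [hS, if_false, Finset.mem_insert, hj, false_or,
          Finset.card_insert_of_notMem hS, pow_succ]
        ring
    · intro S _ _ h
      by_cases hS : j ∈ S
      · rw [if_pos hS] at h
        exact Finset.notMem_erase j S (h.symm ▸ hS)
      · rw [if_neg hS] at h
        exact hS (h ▸ Finset.mem_insert_self j S)
    · intro S _
      by_cases hS : j ∈ S
      · simp [hS]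
      · simp [hS]

section

variable {E : Type*} [AddCommGroup E] [Module ℝ E]

/-- Polarization identity. -/
theorem MultilinearMap.sum_neg_one_pow_card_mul_map_sum {ι : Type*} [Fintype ι] [DecidableEq ι]
    (Q : MultilinearMap ℝ (fun _ : ι => E) ℝ)
    (hQ : ∀ (z : ι → E) (e : Equiv.Perm ι), Q (z ∘ e) = Q z) (z : ι → E) :
    ∑ S : Finset ι, (-1 : ℝ) ^ S.card * Q (fun _ => ∑ j ∈ S, z j) =
      (Fintype.card ι).factorial * ((-1) ^ Fintype.card ι * Q z) := by
  have hexp : ∀ S : Finset ι, Q (fun _ => ∑ j ∈ S, z j) =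
      ∑ f : ι → ι, (∏ i, (if f i ∈ S then (1 : ℝ) else 0)) * Q (z ∘ f) := by
    intro S
    have : (fun _ : ι => ∑ j ∈ S, z j) =
        fun _ => ∑ j, (if j ∈ S then (1 : ℝ) else 0) • z j := by
      funext
      simp [ite_smul]
    rw [this, MultilinearMap.map_sum]
    exact Finset.sum_congr rfl fun f _ => Q.map_smul_univ (fun i => if f i ∈ S then 1 else 0) _
  simp only [hexp, Finset.mul_sum]
  rw [Finset.sum_comm]
  simp only [← mul_assoc, ← Finset.sum_mul, sum_neg_one_pow_card_mul_prod_indicator]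
  have hterm : ∀ f : ι → ι,
      (if Function.Surjective f then (-1 : ℝ) ^ Fintype.card ι else 0) * Q (z ∘ f) =
      if Function.Bijective f then (-1) ^ Fintype.card ι * Q z else 0 := by
    intro f
    by_cases hf : Function.Bijective f
    · rw [if_pos hf, if_pos hf.2]
      congr 1
      exact hQ z (Equiv.ofBijective f hf)
    · rw [if_neg hf, if_neg fun h => hf h.bijective_of_finite, zero_mul]
  simp only [hterm]
  rw [← Finset.sum_filter, Finset.sum_const, nsmul_eq_mul, ← mul_assoc]
  congr 3
  rw [← Fintype.card_subtype, ← Fintype.card_congr (Equiv.ofBijective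
    (fun e : Equiv.Perm ι => (⟨e, e.bijective⟩ : {f : ι → ι // Function.Bijective f}))
    ⟨fun a b h => Equiv.ext (congrFun (congrArg Subtype.val h)),
      fun f => ⟨Equiv.ofBijective f.1 f.2, rfl⟩⟩), Fintype.card_perm]

/-- A bound for a symmetric multilinear form on the diagonal of a convex set containing `0`
gives a bound for arbitrary arguments in that set. -/
theorem MultilinearMap.abs_le_of_abs_diag_le {k : ℕ} (Q : MultilinearMap ℝ (fun _ : Fin k => E) ℝ)
    (hQ : ∀ (z : Fin k → E) (e : Equiv.Perm (Fin k)), Q (z ∘ e) = Q z)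
    {K : Set E} (hK : Convex ℝ K) (h0 : (0 : E) ∈ K) {M : ℝ}
    (hM : ∀ z ∈ K, |Q (fun _ => z)| ≤ M) (z : Fin k → E) (hz : ∀ i, z i ∈ K) :
    |Q z| ≤ (2 * k) ^ k * M := by
  have hM0 : 0 ≤ M := (abs_nonneg _).trans (hM 0 h0)
  have hpol := Q.sum_neg_one_pow_card_mul_map_sum hQ z
  have hS : ∀ S : Finset (Fin k), |(-1 : ℝ) ^ S.card * Q (fun _ => ∑ j ∈ S, z j)| ≤ k ^ k * M := by
    intro S
    have hmem : ∑ j : Fin k, ((k : ℝ)⁻¹) • (if j ∈ S then z j else 0) ∈ K ∨ k = 0 := by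
      rcases Nat.eq_zero_or_pos k with hk | hk
      · exact Or.inr hk
      refine Or.inl (hK.sum_mem (fun _ _ => by positivity) ?_ fun j _ => ?_)
      · simp [hk.ne']
      · split_ifs
        exacts [hz j, h0]
    rcases hmem with hmem | rfl
    · set w := ∑ j : Fin k, ((k : ℝ)⁻¹) • (if j ∈ S then z j else 0)
      have hw : ∑ j ∈ S, z j = (k : ℝ) • w := by
        rcases Nat.eq_zero_or_pos k with rfl | hk
        · simp [Subsingleton.elim S ∅]
        simp only [w]
        rw [← Finset.smul_sum, smul_smul, mul_inv_cancel₀ (by positivity), one_smul]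
        simp
      have h1 := Q.map_smul_univ (fun _ => (k : ℝ)) (fun _ => w)
      rw [hw, h1, abs_mul, abs_pow, abs_neg, abs_one, one_pow, one_mul, smul_eq_mul, abs_mul]
      simpa using mul_le_mul_of_nonneg_left (hM w hmem) (by positivity : (0 : ℝ) ≤ (k : ℝ) ^ k)
    · have h1 := hM 0 h0
      rw [abs_mul, abs_pow, abs_neg, abs_one, one_pow, one_mul]
      simpa [Subsingleton.elim S ∅] using h1
  calc |Q z| ≤ (Fintype.card (Fin k)).factorial * |Q z| :=
        le_mul_of_one_le_left (abs_nonneg _)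
          (by exact_mod_cast Nat.one_le_iff_ne_zero.2 (Nat.factorial_ne_zero _))
    _ = |∑ S : Finset (Fin k), (-1 : ℝ) ^ S.card * Q (fun _ => ∑ j ∈ S, z j)| := by
        rw [hpol, abs_mul, abs_mul, abs_pow, abs_neg, abs_one, one_pow, one_mul, Nat.abs_cast]
    _ ≤ ∑ _S : Finset (Fin k), (k : ℝ) ^ k * M :=
        (Finset.abs_sum_le_sum_abs _ _).trans (Finset.sum_le_sum fun S _ => hS S)
    _ = (2 * k) ^ k * M := by
        simp [mul_pow, mul_assoc]

/-- A bound for a multilinear form on a set passes to half of its difference set. -/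
theorem MultilinearMap.abs_le_of_mem_half_sub {k : ℕ}
    (Q : MultilinearMap ℝ (fun _ : Fin k => E) ℝ) {K : Set E} {M : ℝ}
    (hM : ∀ z : Fin k → E, (∀ i, z i ∈ K) → |Q z| ≤ M)
    (z : Fin k → E) (hz : ∀ i, z i ∈ (2⁻¹ : ℝ) • (K - K)) : |Q z| ≤ M := by
  have hz' : ∀ i, ∃ u ∈ K, ∃ v ∈ K, z i = (2⁻¹ : ℝ) • (u - v) := by
    intro i
    obtain ⟨_, ⟨u, hu, v, hv, rfl⟩, h⟩ := hz i
    exact ⟨u, hu, v, hv, h.symm⟩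
  choose u hu v hv huv using hz'
  have hsum : z = fun i => ∑ b : Bool,
      (if b then (2⁻¹ : ℝ) else -2⁻¹) • (if b then u i else v i) := by
    funext i
    simp [huv i, sub_eq_add_neg]
  rw [hsum, MultilinearMap.map_sum]
  refine (Finset.abs_sum_le_sum_abs _ _).trans ?_
  calc _ ≤ ∑ _r : Fin k → Bool, (2⁻¹ : ℝ) ^ k * M := by
        refine Finset.sum_le_sum fun r _ => ?_
        have h1 := Q.map_smul_univ (fun i => if r i then (2⁻¹ : ℝ) else -2⁻¹)
          (fun i => if r i then u i else v i)
        rw [h1, smul_eq_mul, abs_mul, Finset.abs_prod]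
        have h2 : ∀ i, |if r i then (2⁻¹ : ℝ) else -2⁻¹| = 2⁻¹ := by
          intro i
          split_ifs <;> norm_num
        simp only [h2, Finset.prod_const, Finset.card_univ, Fintype.card_fin]
        refine mul_le_mul_of_nonneg_left (hM _ fun i => ?_) (by positivity)
        split_ifs
        exacts [hu i, hv i]
    _ = M := by
        simp

/-- A bound for a multilinear form on a set extends by homogeneity to the points absorbed by
that set. -/
theorem MultilinearMap.abs_le_mul_prod_gauge {k : ℕ}
    (Q : MultilinearMap ℝ (fun _ : Fin k => E) ℝ) {B : Set E} {M : ℝ} (hM0 : 0 ≤ M)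
    (hM : ∀ z : Fin k → E, (∀ i, z i ∈ B) → |Q z| ≤ M)
    (z : Fin k → E) (hz : ∀ i, ∃ r : ℝ, 0 < r ∧ z i ∈ r • B) :
    |Q z| ≤ M * ∏ i, gauge B (z i) := by
  have hε : ∀ ε : ℝ, 0 < ε → |Q z| ≤ M * ∏ i, (gauge B (z i) + ε) := by
    intro ε hε
    have hr : ∀ i, ∃ r : ℝ, 0 < r ∧ z i ∈ r • B ∧ r < gauge B (z i) + ε := by
      intro i
      obtain ⟨r, ⟨h0, h1⟩, h2⟩ := exists_lt_of_csInf_lt (s := {r : ℝ | 0 < r ∧ z i ∈ r • B})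
        (hz i) (lt_add_of_pos_right (gauge B (z i)) hε)
      exact ⟨r, h0, h1, h2⟩
    choose r hr0 hrm hrlt using hr
    choose w hw hwz using hrm
    have hzw : z = fun i => r i • w i := funext fun i => (hwz i).symm
    calc |Q z| = (∏ i, r i) * |Q w| := by
          conv_lhs => rw [hzw]
          rw [Q.map_smul_univ, smul_eq_mul, abs_mul,
            abs_of_nonneg (Finset.prod_nonneg fun i _ => (hr0 i).le)]
      _ ≤ (∏ i, r i) * M :=
          mul_le_mul_of_nonneg_left (hM w hw) (Finset.prod_nonneg fun i _ => (hr0 i).le)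
      _ = M * ∏ i, r i := mul_comm _ _
      _ ≤ M * ∏ i, (gauge B (z i) + ε) :=
          mul_le_mul_of_nonneg_left
            (Finset.prod_le_prod (fun i _ => (hr0 i).le) fun i _ => (hrlt i).le) hM0
  have hcont : Continuous fun ε : ℝ => M * ∏ i, (gauge B (z i) + ε) := by fun_prop
  have hlim := (hcont.tendsto 0).mono_left (nhdsWithin_le_nhds (s := Set.Ioi 0))
  simp only [add_zero] at hlim
  exact ge_of_tendsto hlim (Filter.eventually_of_mem self_mem_nhdsWithin hε)

theorem exists_pos_mem_smul_half_sub {K : Set E} (hK : Convex ℝ K) (h0 : (0 : E) ∈ K) {x : E}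
    (hx : x ∈ Submodule.span ℝ K) : ∃ r : ℝ, 0 < r ∧ x ∈ r • ((2⁻¹ : ℝ) • (K - K)) := by
  have hB : Convex ℝ ((2⁻¹ : ℝ) • (K - K)) := (hK.sub hK).smul _
  have hB0 : (0 : E) ∈ (2⁻¹ : ℝ) • (K - K) := ⟨0, ⟨0, h0, 0, h0, by simp⟩, by simp⟩
  induction hx using Submodule.span_induction with
  | mem x hx =>
    exact ⟨2, two_pos, (2⁻¹ : ℝ) • x, ⟨x, ⟨x, hx, 0, h0, by simp⟩, rfl⟩, by simp⟩
  | zero => exact ⟨1, one_pos, 0, hB0, by simp⟩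
  | add x y _ _ hx hy =>
    obtain ⟨r, hr, hx⟩ := hx
    obtain ⟨s, hs, hy⟩ := hy
    exact ⟨r + s, by positivity, by rw [hB.add_smul hr.le hs.le]; exact Set.add_mem_add hx hy⟩
  | smul c x _ hx =>
    obtain ⟨r, hr, _, ⟨_, ⟨u, hu, v, hv, rfl⟩, rfl⟩, rfl⟩ := hx
    rcases lt_trichotomy c 0 with hc | rfl | hc
    · refine ⟨-c * r, by nlinarith, (2⁻¹ : ℝ) • (v - u), ⟨_, ⟨v, hv, u, hu, rfl⟩, rfl⟩, ?_⟩
      simp only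
      module
    · exact ⟨1, one_pos, 0, hB0, by simp⟩
    · exact ⟨c * r, by positivity, (2⁻¹ : ℝ) • (u - v), ⟨_, ⟨u, hu, v, hv, rfl⟩, rfl⟩, by
        simp only
        module⟩

end

theorem MultilinearMap.continuous_diag {E : Type*} [NormedAddCommGroup E] [NormedSpace ℝ E]
    [FiniteDimensional ℝ E] {k : ℕ} (Q : MultilinearMap ℝ (fun _ : Fin k => E) ℝ) :
    Continuous fun z : E => Q fun _ => z := by
  let b := Module.finBasis ℝ E
  have hexp : (fun z : E => Q fun _ => z) =
      fun z => ∑ f : Fin k → Fin (Module.finrank ℝ E),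
        (∏ i, b.equivFun z (f i)) * Q fun i => b (f i) := by
    funext z
    have hz : (fun _ : Fin k => z) = fun _ => ∑ j, b.equivFun z j • b j :=
      funext fun _ => (b.sum_equivFun z).symm
    conv_lhs => rw [hz, MultilinearMap.map_sum]
    exact Finset.sum_congr rfl fun f _ => Q.map_smul_univ (fun i => b.equivFun z (f i)) _
  have hb : Continuous b.equivFun := b.equivFun.toLinearMap.continuous_of_finiteDimensional
  rw [hexp]
  fun_prop

/-- For every `d ≥ 2` there is `C > 0` depending only on `d` such that:
for all symmetric `k`-linear forms `Q_k` (`2 ≤ k ≤ d`) on a finite-dimensional real inner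
product space `E`, with `Ẑ = conv({0} ∪ Z)`, `φ̂(z) = Σ_{k=2}^d Q_k(z,…,z)` and
`V = sup_Ẑ φ̂ − inf_Ẑ φ̂`, one has `|Q_k(z¹,…,z^k)| ≤ C·V·∏ᵢ ‖zⁱ‖_Ẑ` for all `zⁱ ∈ span Ẑ`,
`‖·‖_Ẑ` being the gauge of `½[Ẑ−Ẑ]`. -/
theorem stmt_3 (d : ℕ) (hd : 2 ≤ d) :
    ∃ C : ℝ, 0 < C ∧
      ∀ (E : Type) (_ : NormedAddCommGroup E) (_ : InnerProductSpace ℝ E)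
        (_ : FiniteDimensional ℝ E)
        (Z : Set E), Z.Nonempty → Convex ℝ Z → IsCompact Z →
        ∀ (Q : (k : ℕ) → MultilinearMap ℝ (fun _ : Fin k => E) ℝ),
          (∀ k, 2 ≤ k → k ≤ d →
            ∀ (z : Fin k → E) (e : Equiv.Perm (Fin k)), Q k (z ∘ e) = Q k z) →
          ∀ (Zhat : Set E), Zhat = convexHull ℝ ({0} ∪ Z) →
          ∀ (phihat : E → ℝ),
            (phihat = fun z => ∑ k ∈ Finset.Icc 2 d, Q k (fun _ => z)) →
          ∀ (V : ℝ), V = sSup (phihat '' Zhat) - sInf (phihat '' Zhat) →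
          ∀ k, 2 ≤ k → k ≤ d →
            ∀ zs : Fin k → E, (∀ i, zs i ∈ Submodule.span ℝ Zhat) →
              |Q k zs| ≤ C * V * ∏ i, gauge ((2⁻¹ : ℝ) • (Zhat - Zhat)) (zs i) := by
  obtain ⟨C, hC, hcoeff⟩ := exists_coeff_bound d
  refine ⟨C * (2 * d) ^ d, by positivity, ?_⟩
  intro E _ _ _ Z hZne _ hZ Q hQ K hKdef φ hφ V hV k hk2 hkd zs hzs
  have hK : Convex ℝ K := hKdef ▸ convex_convexHull ℝ _
  have h0 : (0 : E) ∈ K := hKdef ▸ subset_convexHull ℝ _ (Or.inl rfl)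
  have hKb : Bornology.IsBounded K := by
    rw [hKdef, isBounded_convexHull]
    exact Bornology.isBounded_singleton.union hZ.isBounded
  have hφc : Continuous φ := by
    rw [hφ]
    exact continuous_finsetSum _ fun k _ => (Q k).continuous_diag
  have hφb : Bornology.IsBounded (φ '' K) :=
    (hKb.isCompact_closure.image hφc).isBounded.subset (Set.image_mono subset_closure)
  have hdiag : ∀ k (t : ℝ) (z : E), Q k (fun _ => t • z) = t ^ k * Q k fun _ => z := fun k t z => by
    simpa using (Q k).map_smul_univ (fun _ => t) (fun _ => z)
  have hφ0 : φ 0 = 0 := by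
    rw [hφ]
    refine Finset.sum_eq_zero fun k hk => ?_
    have : k ≠ 0 := by have := (Finset.mem_Icc.1 hk).1; omega
    simpa [this] using hdiag k 0 0
  have hφV : ∀ z ∈ K, |φ z| ≤ V := by
    intro z hz
    have h1 := le_csSup hφb.bddAbove (Set.mem_image_of_mem φ hz)
    have h2 := csInf_le hφb.bddBelow (Set.mem_image_of_mem φ hz)
    have h3 := le_csSup hφb.bddAbove (Set.mem_image_of_mem φ h0)
    have h4 := csInf_le hφb.bddBelow (Set.mem_image_of_mem φ h0)
    rw [hφ0] at h3 h4
    rw [hV, abs_le]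
    constructor <;> linarith
  have hV0 : 0 ≤ V := (abs_nonneg _).trans (hφV 0 h0)
  have hQdiag : ∀ z ∈ K, |Q k fun _ => z| ≤ C * V := by
    intro z hz
    have h := hcoeff (fun j => if 2 ≤ (j : ℕ) then Q j (fun _ => z) else 0) V ?_
      ⟨k, Nat.lt_succ_of_le hkd⟩
    · simpa [hk2] using h
    intro t ht
    have htz : t • z ∈ K := by
      simpa using hK.smul_mem_of_zero_mem h0 hz ht
    convert hφV _ htz using 2
    rw [hφ, Fin.sum_univ_eq_sum_range
      (fun j => (if 2 ≤ j then Q j (fun _ => z) else 0) * t ^ j) (d + 1)]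
    simp only [hdiag, ite_mul, zero_mul]
    rw [← Finset.sum_filter]
    refine Finset.sum_congr ?_ fun j _ => mul_comm _ _
    ext j
    simp only [Finset.mem_filter, Finset.mem_range, Finset.mem_Icc]
    omega
  have hQK := (Q k).abs_le_of_abs_diag_le (hQ k hk2 hkd) hK h0 hQdiag
  have hpow : ((2 : ℝ) * k) ^ k ≤ (2 * d) ^ d := by
    have hkd' : (k : ℝ) ≤ d := by exact_mod_cast hkd
    have hd' : (2 : ℝ) ≤ d := by exact_mod_cast hd
    calc ((2 : ℝ) * k) ^ k ≤ (2 * d) ^ k := by gcongr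
      _ ≤ (2 * d) ^ d := pow_le_pow_right₀ (by linarith) hkd
  refine (Q k).abs_le_mul_prod_gauge (by positivity) ((Q k).abs_le_of_mem_half_sub
    fun z hz => (hQK z hz).trans ?_) zs fun i => exists_pos_mem_smul_half_sub hK h0 (hzs i)
  calc (2 * (k : ℝ)) ^ k * (C * V) ≤ (2 * d) ^ d * (C * V) := by gcongr
    _ = C * (2 * d) ^ d * V := by ring
end

section
/- Let m, n, k be integers with m ≥ n ≥ k ≥ 1, let F be a linear subspace of S^m such that every matrix y ∈ F has at most n nonzero eigenvalues, let q ∈ (0, 1), and define χ(y) = (1/(1+q))·Σ_{j=1}^m |λ_j(y)|^{1+q} on S^m. Then χ is continuously differentiable and convex on S^m, and its restriction to Y^k_F = {y ∈ F : ‖λ(y)‖_∞ ≤ 1 and ‖λ(y)‖_1 ≤ k} is strongly convex with modulus β = q·min(1, (1/2)·k^{1+q}·n^{−q}) with respect to the norm ‖y‖_{(k)} = max(‖λ(y)‖_∞, ‖λ(y)‖_1/k). -/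
open Matrix

attribute [local instance] Matrix.frobeniusNormedAddCommGroup Matrix.frobeniusNormedSpace

/-! ### The scalar function `|s|^(1+q) / (1+q)` and its derivative -/

/-- The derivative `sign s * |s| ^ q` of `|s| ^ (1 + q) / (1 + q)`. -/
noncomputable def signedRpow (q s : ℝ) : ℝ := |s| ^ (q - 1) * s

lemma signedRpow_of_nonneg {q s : ℝ} (hq : 0 < q) (hs : 0 ≤ s) : signedRpow q s = s ^ q := by
  rcases hs.eq_or_lt with rfl | hs
  · simp [signedRpow, Real.zero_rpow hq.ne']
  · rw [signedRpow, abs_of_pos hs, Real.rpow_sub_one hs.ne', div_mul_cancel₀ _ hs.ne']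

lemma signedRpow_neg (q s : ℝ) : signedRpow q (-s) = -signedRpow q s := by
  simp [signedRpow]

lemma hasDerivAt_abs_rpow_div {q : ℝ} (hq : 0 < q) (s : ℝ) :
    HasDerivAt (fun x : ℝ => 1 / (1 + q) * |x| ^ (1 + q)) (signedRpow q s) s := by
  have h := (hasDerivAt_abs_rpow s (p := 1 + q) (by linarith)).const_mul (1 / (1 + q))
  refine h.congr_deriv ?_
  have : 1 + q ≠ 0 := by linarith
  rw [signedRpow, show (1 + q - 2) = q - 1 by ring]
  field_simp

lemma abs_rpow_sub_rpow_le {q s t : ℝ} (hq0 : 0 < q) (hq1 : q < 1) (hs : 0 ≤ s) (ht : 0 ≤ t) :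
    |s ^ q - t ^ q| ≤ |s - t| ^ q := by
  wlog hst : t ≤ s generalizing s t
  · rw [abs_sub_comm, abs_sub_comm s t]
    exact this ht hs (le_of_not_ge hst)
  rw [abs_of_nonneg (sub_nonneg.2 (Real.rpow_le_rpow ht hst hq0.le)),
    abs_of_nonneg (sub_nonneg.2 hst)]
  have := Real.rpow_add_le_add_rpow (sub_nonneg.2 hst) ht hq0.le hq1.le
  rw [sub_add_cancel] at this
  linarith

lemma abs_signedRpow_sub_le {q : ℝ} (hq0 : 0 < q) (hq1 : q < 1) (s t : ℝ) :
    |signedRpow q s - signedRpow q t| ≤ 2 * |s - t| ^ q := by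
  wlog hs : 0 ≤ s generalizing s t
  · have := this (-s) (-t) (by linarith)
    rwa [signedRpow_neg, signedRpow_neg, ← neg_sub', abs_neg, ← neg_sub', abs_neg] at this
  rw [signedRpow_of_nonneg hq0 hs]
  rcases le_total 0 t with ht | ht
  · rw [signedRpow_of_nonneg hq0 ht]
    have h1 := abs_rpow_sub_rpow_le hq0 hq1 hs ht
    have h2 : 0 ≤ |s - t| ^ q := by positivity
    linarith
  · obtain ⟨r, rfl⟩ : ∃ r, t = -r := ⟨-t, by ring⟩
    have hr : 0 ≤ r := by linarith
    rw [signedRpow_neg, signedRpow_of_nonneg hq0 hr, sub_neg_eq_add, sub_neg_eq_add,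
      abs_of_nonneg (by positivity), abs_of_nonneg (by positivity)]
    have h1 : s ^ q ≤ (s + r) ^ q := Real.rpow_le_rpow hs (by linarith) hq0.le
    have h2 : r ^ q ≤ (s + r) ^ q := Real.rpow_le_rpow hr (by linarith) hq0.le
    linarith

lemma monotoneOn_rpow_sub_mul {q M : ℝ} (hq0 : 0 < q) (hq1 : q < 1) :
    MonotoneOn (fun s : ℝ => s ^ q - q * M ^ (q - 1) * s) (Set.Icc 0 M) := by
  have hd : ∀ s ∈ interior (Set.Icc 0 M), HasDerivAt (fun s : ℝ => s ^ q - q * M ^ (q - 1) * s)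
      (q * s ^ (q - 1) - q * M ^ (q - 1)) s := by
    intro s hs
    rw [interior_Icc] at hs
    have h1 := Real.hasDerivAt_rpow_const (x := s) (p := q) (Or.inl hs.1.ne')
    exact (h1.sub ((hasDerivAt_id s).const_mul (q * M ^ (q - 1)))).congr_deriv (by simp)
  refine monotoneOn_of_deriv_nonneg (convex_Icc 0 M) ?_
    (fun s hs => (hd s hs).differentiableAt.differentiableWithinAt) fun s hs => ?_
  · exact ((Real.continuous_rpow_const hq0.le).sub (continuous_const.mul continuous_id)).continuousOn
  · rw [(hd s hs).deriv, ← mul_sub]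
    rw [interior_Icc] at hs
    have := Real.rpow_le_rpow_of_nonpos hs.1 hs.2.le (by linarith : q - 1 ≤ 0)
    exact mul_nonneg hq0.le (by linarith)

lemma monotoneOn_signedRpow_sub_mul {q M : ℝ} (hq0 : 0 < q) (hq1 : q < 1) (hM : 0 < M) :
    MonotoneOn (fun s => signedRpow q s - q * M ^ (q - 1) * s) (Set.Icc (-M) M) := by
  have hpos : ∀ s ∈ Set.Icc 0 M, ∀ t ∈ Set.Icc 0 M, s ≤ t →
      signedRpow q s - q * M ^ (q - 1) * s ≤ signedRpow q t - q * M ^ (q - 1) * t := by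
    intro s hs t ht hst
    rw [signedRpow_of_nonneg hq0 hs.1, signedRpow_of_nonneg hq0 ht.1]
    exact monotoneOn_rpow_sub_mul hq0 hq1 hs ht hst
  have hzero : signedRpow q 0 = 0 := by simp [signedRpow]
  have h0 : (0 : ℝ) ∈ Set.Icc 0 M := ⟨le_rfl, hM.le⟩
  intro s hs t ht hst
  obtain ⟨hs1, hs2⟩ := hs
  obtain ⟨ht1, ht2⟩ := ht
  show signedRpow q s - q * M ^ (q - 1) * s ≤ signedRpow q t - q * M ^ (q - 1) * t
  rcases le_total 0 s with h | h
  · exact hpos s ⟨h, hs2⟩ t ⟨h.trans hst, ht2⟩ hst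
  rcases le_total 0 t with h' | h'
  · have h1 := hpos 0 h0 (-s) ⟨by linarith, by linarith⟩ (by linarith)
    have h2 := hpos 0 h0 t ⟨h', ht2⟩ h'
    rw [signedRpow_neg] at h1
    linarith
  · have h1 := hpos (-t) ⟨by linarith, by linarith⟩ (-s) ⟨by linarith, by linarith⟩ (by linarith)
    rw [signedRpow_neg, signedRpow_neg] at h1
    linarith

lemma ConvexOn.add_mul_sub_le {S : Set ℝ} {f : ℝ → ℝ} (hf : ConvexOn ℝ S f) {x y f' : ℝ}
    (hx : x ∈ S) (hy : y ∈ S) (h : HasDerivAt f f' x) : f x + f' * (y - x) ≤ f y := by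
  rcases lt_trichotomy x y with hxy | rfl | hxy
  · have := hf.le_slope_of_hasDerivAt hx hy hxy h
    rw [slope_def_field, le_div_iff₀ (by linarith)] at this
    linarith
  · simp
  · have := hf.slope_le_of_hasDerivAt hy hx hxy h
    rw [slope_def_field, div_le_iff₀ (by linarith)] at this
    linarith

/-- The Bregman divergence of `|s| ^ (1 + q) / (1 + q)`. -/
noncomputable def bregmanRpow (q s t : ℝ) : ℝ :=
  1 / (1 + q) * |s| ^ (1 + q) - 1 / (1 + q) * |t| ^ (1 + q) - signedRpow q t * (s - t)

lemma rpow_mul_sq_le_bregmanRpow {q M s t : ℝ} (hq0 : 0 < q) (hq1 : q < 1) (hM : 0 < M)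
    (hs : |s| ≤ M) (ht : |t| ≤ M) :
    q / 2 * M ^ (q - 1) * (s - t) ^ 2 ≤ bregmanRpow q s t := by
  set c := q * M ^ (q - 1) with hc
  have hd : ∀ x : ℝ, HasDerivAt (fun x : ℝ => 1 / (1 + q) * |x| ^ (1 + q) - c / 2 * x ^ 2)
      (signedRpow q x - c * x) x := by
    intro x
    refine ((hasDerivAt_abs_rpow_div hq0 x).sub ((hasDerivAt_pow 2 x).const_mul (c / 2))).congr_deriv
      ?_
    norm_num
    ring
  have hconv : ConvexOn ℝ (Set.Icc (-M) M)
      (fun x : ℝ => 1 / (1 + q) * |x| ^ (1 + q) - c / 2 * x ^ 2) := by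
    refine MonotoneOn.convexOn_of_deriv (convex_Icc _ _)
      (fun x _ => (hd x).continuousAt.continuousWithinAt)
      (fun x _ => (hd x).differentiableAt.differentiableWithinAt) ?_
    have : deriv (fun x : ℝ => 1 / (1 + q) * |x| ^ (1 + q) - c / 2 * x ^ 2) =
      fun x => signedRpow q x - c * x := funext fun x => (hd x).deriv
    rw [this]
    exact (monotoneOn_signedRpow_sub_mul hq0 hq1 hM).mono interior_subset
  have := hconv.add_mul_sub_le (abs_le.1 ht) (abs_le.1 hs) (hd t)
  rw [bregmanRpow]
  rw [show q / 2 * M ^ (q - 1) = c / 2 by rw [hc]; ring]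
  nlinarith

lemma bregmanRpow_self (q t : ℝ) : bregmanRpow q t t = 0 := by simp [bregmanRpow]

lemma sq_sub_le_bregmanRpow {q s t : ℝ} (hq0 : 0 < q) (hq1 : q < 1) (hs : |s| ≤ 1)
    (ht : |t| ≤ 1) : (s - t) ^ 2 ≤ 2 / q * bregmanRpow q s t := by
  have := rpow_mul_sq_le_bregmanRpow hq0 hq1 one_pos hs ht
  rw [Real.one_rpow] at this
  rw [div_mul_eq_mul_div, le_div_iff₀ hq0]
  linarith

lemma sq_sub_le_bregmanRpow_mul {q : ℝ} (hq0 : 0 < q) (hq1 : q < 1) (s t : ℝ) :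
    (s - t) ^ 2 ≤ 2 / q * bregmanRpow q s t * (|s| ^ (1 - q) + |t| ^ (1 - q)) := by
  rcases (abs_nonneg s |>.trans (le_max_left _ |t|)).eq_or_lt with hM | hM
  · have hs : |s| ≤ 0 := hM ▸ le_max_left _ _
    have ht : |t| ≤ 0 := hM ▸ le_max_right _ _
    rw [abs_nonpos_iff] at hs ht
    simp [hs, ht, bregmanRpow_self]
  · have h := rpow_mul_sq_le_bregmanRpow hq0 hq1 hM (le_max_left _ _) (le_max_right _ _)
    set M := max |s| |t| with hMdef
    have hle : M ^ (1 - q) ≤ |s| ^ (1 - q) + |t| ^ (1 - q) := by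
      have h1 : 0 ≤ |s| ^ (1 - q) := by positivity
      have h2 : 0 ≤ |t| ^ (1 - q) := by positivity
      rcases max_choice |s| |t| with h' | h' <;> rw [hMdef, h'] <;> linarith
    have hinv : M ^ (q - 1) * M ^ (1 - q) = 1 := by
      rw [← Real.rpow_add hM]; simp
    have hb : 0 ≤ bregmanRpow q s t := le_trans (by positivity) h
    calc (s - t) ^ 2 = 2 / q * (q / 2 * M ^ (q - 1) * (s - t) ^ 2) * M ^ (1 - q) := by
          have : 2 / q * (q / 2 * M ^ (q - 1) * (s - t) ^ 2) * M ^ (1 - q) =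
            (2 / q * (q / 2)) * (M ^ (q - 1) * M ^ (1 - q)) * (s - t) ^ 2 := by ring
          rw [this, hinv]
          field_simp
      _ ≤ _ := by gcongr

lemma bregmanRpow_nonneg {q : ℝ} (hq0 : 0 < q) (hq1 : q < 1) (s t : ℝ) :
    0 ≤ bregmanRpow q s t := by
  have hM : 0 < max |s| |t| + 1 := by positivity
  refine le_trans (by positivity) (rpow_mul_sq_le_bregmanRpow hq0 hq1 hM (s := s) (t := t) ?_ ?_)
  · linarith [le_max_left |s| |t|]
  · linarith [le_max_right |s| |t|]

/-- Hölder's inequality for a vector with at most `n` nonzero entries. -/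
lemma sum_abs_rpow_one_sub_le {ι : Type*} [Fintype ι] {q N K : ℝ} (hq0 : 0 < q) (hq1 : q < 1)
    (hN : 0 < N) (hK : 0 < K) (a : ι → ℝ)
    (hcard : ((Finset.univ.filter fun i => a i ≠ 0).card : ℝ) ≤ N) (hsum : ∑ i, |a i| ≤ K) :
    ∑ i, |a i| ^ (1 - q) ≤ N ^ q * K ^ (1 - q) := by
  have hstep : ∀ i, |a i| ^ (1 - q) ≤
      (K / N) ^ (1 - q) * ((1 - q) * (N / K) * |a i| + if a i ≠ 0 then q else 0) := by
    intro i
    by_cases hi : a i = 0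
    · simp [hi, Real.zero_rpow (by linarith : 1 - q ≠ 0)]
    · have h := Real.geom_mean_le_arith_mean2_weighted (by linarith : 0 ≤ 1 - q) hq0.le
        (by positivity : 0 ≤ N / K * |a i|) zero_le_one (by ring)
      rw [Real.one_rpow, mul_one] at h
      have h2 : |a i| ^ (1 - q) = (K / N) ^ (1 - q) * (N / K * |a i|) ^ (1 - q) := by
        rw [← Real.mul_rpow (by positivity) (by positivity)]
        congr 1
        field_simp
      rw [h2, if_pos hi]
      gcongr
      linarith
  calc ∑ i, |a i| ^ (1 - q)
      ≤ ∑ i, (K / N) ^ (1 - q) * ((1 - q) * (N / K) * |a i| + if a i ≠ 0 then q else 0) :=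
        Finset.sum_le_sum fun i _ => hstep i
    _ = (K / N) ^ (1 - q) * ((1 - q) * (N / K) * ∑ i, |a i| +
          (Finset.univ.filter fun i => a i ≠ 0).card * q) := by
        rw [← Finset.mul_sum, Finset.sum_add_distrib, ← Finset.mul_sum, ← Finset.sum_filter,
          Finset.sum_const, nsmul_eq_mul]
    _ ≤ (K / N) ^ (1 - q) * ((1 - q) * (N / K) * K + N * q) := by
        have : 0 ≤ 1 - q := by linarith
        gcongr
    _ = N ^ q * K ^ (1 - q) := by
        have : (1 - q) * (N / K) * K + N * q = N := by field_simp; ring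
        rw [this, Real.div_rpow hK.le hN.le, Real.rpow_sub hN, Real.rpow_one]
        field_simp

/-! ### Comparing two orthogonal diagonalizations -/

section OrthogonalDiagonalization

variable {ι : Type*} [Fintype ι] [DecidableEq ι]

lemma sum_sq_row_of_mem_orthogonalGroup {C : Matrix ι ι ℝ} (hC : C ∈ orthogonalGroup ι ℝ) (i : ι) :
    ∑ j, C i j ^ 2 = 1 := by
  have := congr_fun₂ ((mem_orthogonalGroup_iff ι ℝ).1 hC) i i
  simpa [Matrix.mul_apply, sq] using this

lemma transpose_mem_orthogonalGroup {C : Matrix ι ι ℝ} (hC : C ∈ orthogonalGroup ι ℝ) :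
    Cᵀ ∈ orthogonalGroup ι ℝ := by
  have := Unitary.star_mem hC
  simpa [star_eq_conjTranspose] using this

lemma transpose_mul_self_of_mem_orthogonalGroup {C : Matrix ι ι ℝ}
    (hC : C ∈ orthogonalGroup ι ℝ) : Cᵀ * C = 1 :=
  (mem_orthogonalGroup_iff' ι ℝ).1 hC

lemma self_mul_transpose_of_mem_orthogonalGroup {C : Matrix ι ι ℝ}
    (hC : C ∈ orthogonalGroup ι ℝ) : C * Cᵀ = 1 :=
  (mem_orthogonalGroup_iff ι ℝ).1 hC

lemma sum_sq_col_of_mem_orthogonalGroup {C : Matrix ι ι ℝ} (hC : C ∈ orthogonalGroup ι ℝ) (j : ι) :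
    ∑ i, C i j ^ 2 = 1 :=
  sum_sq_row_of_mem_orthogonalGroup (transpose_mem_orthogonalGroup hC) j

variable {U V W : Matrix ι ι ℝ}

lemma transpose_mul_mem_orthogonalGroup (hU : U ∈ orthogonalGroup ι ℝ)
    (hV : V ∈ orthogonalGroup ι ℝ) : Uᵀ * V ∈ orthogonalGroup ι ℝ :=
  mul_mem (transpose_mem_orthogonalGroup hU) hV

lemma sum_sum_sq_mul_left (hU : U ∈ orthogonalGroup ι ℝ) (hV : V ∈ orthogonalGroup ι ℝ)
    (a : ι → ℝ) : ∑ i, ∑ j, (Uᵀ * V) i j ^ 2 * a i = ∑ i, a i := by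
  refine Finset.sum_congr rfl fun i _ => ?_
  rw [← Finset.sum_mul,
    sum_sq_row_of_mem_orthogonalGroup (transpose_mul_mem_orthogonalGroup hU hV), one_mul]

lemma sum_sum_sq_mul_right (hU : U ∈ orthogonalGroup ι ℝ) (hV : V ∈ orthogonalGroup ι ℝ)
    (b : ι → ℝ) : ∑ i, ∑ j, (Uᵀ * V) i j ^ 2 * b j = ∑ j, b j := by
  rw [Finset.sum_comm]
  refine Finset.sum_congr rfl fun i _ => ?_
  rw [← Finset.sum_mul,
    sum_sq_col_of_mem_orthogonalGroup (transpose_mul_mem_orthogonalGroup hU hV), one_mul]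

lemma trace_conj_diagonal_mul_left (hV : V ∈ orthogonalGroup ι ℝ) (a : ι → ℝ) (X : Matrix ι ι ℝ) :
    trace (U * diagonal a * Uᵀ * X) = ∑ i, ∑ j, a i * ((Uᵀ * V) i j * (Uᵀ * X * V) i j) := by
  have h1 : trace (U * diagonal a * Uᵀ * X) =
      trace (diagonal a * ((Uᵀ * X * V) * (Uᵀ * V)ᵀ)) := by
    rw [transpose_mul, transpose_transpose]
    have : Uᵀ * X * V * (Vᵀ * U) = Uᵀ * X * (V * Vᵀ) * U := by simp only [Matrix.mul_assoc]
    rw [this, self_mul_transpose_of_mem_orthogonalGroup hV, Matrix.mul_one]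
    rw [Matrix.mul_assoc, Matrix.mul_assoc, trace_mul_comm]
    simp only [Matrix.mul_assoc]
  rw [h1]
  simp only [trace, diag_apply, diagonal_mul, Matrix.mul_apply (M := Uᵀ * X * V),
    Finset.mul_sum, transpose_apply]
  exact Finset.sum_congr rfl fun i _ => Finset.sum_congr rfl fun j _ => by ring

lemma trace_conj_diagonal_mul_right (hU : U ∈ orthogonalGroup ι ℝ) (b : ι → ℝ)
    (X : Matrix ι ι ℝ) :
    trace (V * diagonal b * Vᵀ * X) = ∑ i, ∑ j, b j * ((Uᵀ * V) i j * (Uᵀ * X * V) i j) := by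
  have h1 : trace (V * diagonal b * Vᵀ * X) =
      trace (diagonal b * ((Uᵀ * V)ᵀ * (Uᵀ * X * V))) := by
    rw [transpose_mul, transpose_transpose]
    have : Vᵀ * U * (Uᵀ * X * V) = Vᵀ * (U * Uᵀ) * X * V := by simp only [Matrix.mul_assoc]
    rw [this, self_mul_transpose_of_mem_orthogonalGroup hU, Matrix.mul_one]
    rw [Matrix.mul_assoc, Matrix.mul_assoc, trace_mul_comm]
    simp only [Matrix.mul_assoc]
  rw [h1, Finset.sum_comm]
  simp only [trace, diag_apply, diagonal_mul, Matrix.mul_apply (M := (Uᵀ * V)ᵀ),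
    Finset.mul_sum, transpose_apply]

lemma trace_conj_diagonal_mul_conj_diagonal (hV : V ∈ orthogonalGroup ι ℝ) (a b : ι → ℝ) :
    trace (U * diagonal a * Uᵀ * (V * diagonal b * Vᵀ)) =
      ∑ i, ∑ j, (Uᵀ * V) i j ^ 2 * (a i * b j) := by
  rw [trace_conj_diagonal_mul_left hV]
  have : Uᵀ * (V * diagonal b * Vᵀ) * V = Uᵀ * V * diagonal b * (Vᵀ * V) := by
    simp only [Matrix.mul_assoc]
  rw [this, transpose_mul_self_of_mem_orthogonalGroup hV, Matrix.mul_one]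
  simp only [mul_diagonal]
  exact Finset.sum_congr rfl fun i _ => Finset.sum_congr rfl fun j _ => by ring

lemma trace_sub_mul_conj_diagonal (hU : U ∈ orthogonalGroup ι ℝ) (hV : V ∈ orthogonalGroup ι ℝ)
    (a b : ι → ℝ) (X : Matrix ι ι ℝ) :
    trace ((U * diagonal a * Uᵀ - V * diagonal b * Vᵀ) * X) =
      ∑ i, ∑ j, (a i - b j) * ((Uᵀ * V) i j * (Uᵀ * X * V) i j) := by
  rw [Matrix.sub_mul, trace_sub, trace_conj_diagonal_mul_left hV, trace_conj_diagonal_mul_right hU]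
  simp only [← Finset.sum_sub_distrib, sub_mul]

lemma trace_conj_diagonal_mul_self (hW : W ∈ orthogonalGroup ι ℝ) (c d : ι → ℝ) :
    trace (W * diagonal c * Wᵀ * (W * diagonal d * Wᵀ)) = ∑ i, c i * d i := by
  rw [trace_conj_diagonal_mul_conj_diagonal hW, transpose_mul_self_of_mem_orthogonalGroup hW]
  refine Finset.sum_congr rfl fun i _ => ?_
  rw [Finset.sum_eq_single i] <;> simp +contextual [eq_comm]

/-- The Frobenius norm of a difference in terms of the two diagonalizations. -/
lemma trace_sq_sub_conj_diagonal (hU : U ∈ orthogonalGroup ι ℝ) (hV : V ∈ orthogonalGroup ι ℝ)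
    (a b : ι → ℝ) :
    trace ((U * diagonal a * Uᵀ - V * diagonal b * Vᵀ) * (U * diagonal a * Uᵀ - V * diagonal b * Vᵀ))
      = ∑ i, ∑ j, (Uᵀ * V) i j ^ 2 * (a i - b j) ^ 2 := by
  rw [trace_sub_mul_conj_diagonal hU hV]
  have h1 : Uᵀ * (U * diagonal a * Uᵀ - V * diagonal b * Vᵀ) * V =
      diagonal a * (Uᵀ * V) - (Uᵀ * V) * diagonal b := by
    rw [Matrix.mul_sub, Matrix.sub_mul]
    have e1 : Uᵀ * (U * diagonal a * Uᵀ) * V = (Uᵀ * U) * diagonal a * (Uᵀ * V) := by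
      simp only [Matrix.mul_assoc]
    have e2 : Uᵀ * (V * diagonal b * Vᵀ) * V = (Uᵀ * V) * diagonal b * (Vᵀ * V) := by
      simp only [Matrix.mul_assoc]
    rw [e1, e2, transpose_mul_self_of_mem_orthogonalGroup hU,
      transpose_mul_self_of_mem_orthogonalGroup hV, Matrix.one_mul, Matrix.mul_one]
  rw [h1]
  simp only [Matrix.sub_apply, diagonal_mul, mul_diagonal]
  exact Finset.sum_congr rfl fun i _ => Finset.sum_congr rfl fun j _ => by ring

/-- The Bregman divergence of the spectral function `∑ |λ| ^ (1 + q) / (1 + q)`. -/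
lemma sum_sum_sq_mul_bregmanRpow (hU : U ∈ orthogonalGroup ι ℝ) (hV : V ∈ orthogonalGroup ι ℝ)
    (q : ℝ) (a b : ι → ℝ) :
    ∑ i, ∑ j, (Uᵀ * V) i j ^ 2 * bregmanRpow q (a i) (b j) =
      1 / (1 + q) * ∑ i, |a i| ^ (1 + q) - 1 / (1 + q) * ∑ j, |b j| ^ (1 + q) -
        trace ((U * diagonal a * Uᵀ - V * diagonal b * Vᵀ) *
          (V * diagonal (fun j => signedRpow q (b j)) * Vᵀ)) := by
  rw [Matrix.sub_mul, trace_sub, trace_conj_diagonal_mul_self hV,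
    trace_conj_diagonal_mul_conj_diagonal hV,
    ← sum_sum_sq_mul_left hU hV (fun i => |a i| ^ (1 + q)),
    ← sum_sum_sq_mul_right hU hV (fun i => |b i| ^ (1 + q)),
    ← sum_sum_sq_mul_right hU hV (fun j => b j * signedRpow q (b j))]
  simp only [Finset.mul_sum, ← Finset.sum_sub_distrib]
  exact Finset.sum_congr rfl fun i _ => Finset.sum_congr rfl fun j _ => by rw [bregmanRpow]; ring

/-- The matrix sign of `W diag(ν) Wᵀ`, with `sign 0 = 1`, is orthogonal. -/
lemma conj_diagonal_sign_mem_orthogonalGroup (hW : W ∈ orthogonalGroup ι ℝ) (ν : ι → ℝ) :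
    W * diagonal (fun i => if 0 ≤ ν i then (1 : ℝ) else -1) * Wᵀ ∈ orthogonalGroup ι ℝ := by
  refine mul_mem (mul_mem hW ?_) (transpose_mem_orthogonalGroup hW)
  rw [mem_orthogonalGroup_iff, diagonal_transpose, diagonal_mul_diagonal,
    ← diagonal_one]
  congr 1
  ext i
  by_cases h : 0 ≤ ν i <;> simp [h]

lemma trace_conj_diagonal_mul_sign (hW : W ∈ orthogonalGroup ι ℝ) (ν : ι → ℝ) :
    trace (W * diagonal ν * Wᵀ * (W * diagonal (fun i => if 0 ≤ ν i then (1 : ℝ) else -1) * Wᵀ)) =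
      ∑ i, |ν i| := by
  rw [trace_conj_diagonal_mul_self hW]
  refine Finset.sum_congr rfl fun i _ => ?_
  by_cases h : 0 ≤ ν i
  · simp [h, abs_of_nonneg]
  · simp [h, abs_of_neg (not_le.1 h)]

/-- Lower bound of the Bregman divergence by the squared trace norm of the difference. -/
lemma sq_sum_abs_le_bregman {q : ℝ} (hq0 : 0 < q) (hq1 : q < 1)
    (hU : U ∈ orthogonalGroup ι ℝ) (hV : V ∈ orthogonalGroup ι ℝ) (hW : W ∈ orthogonalGroup ι ℝ)
    {a b ν : ι → ℝ} (h : U * diagonal a * Uᵀ - V * diagonal b * Vᵀ = W * diagonal ν * Wᵀ) :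
    (∑ i, |ν i|) ^ 2 ≤
      (2 / q * ∑ i, ∑ j, (Uᵀ * V) i j ^ 2 * bregmanRpow q (a i) (b j)) *
        (∑ i, |a i| ^ (1 - q) + ∑ j, |b j| ^ (1 - q)) := by
  set S := W * diagonal (fun i => if 0 ≤ ν i then (1 : ℝ) else -1) * Wᵀ with hS
  have hSmem : S ∈ orthogonalGroup ι ℝ := conj_diagonal_sign_mem_orthogonalGroup hW ν
  have hSU : Sᵀ * U ∈ orthogonalGroup ι ℝ := transpose_mul_mem_orthogonalGroup hSmem hU
  have hR : Uᵀ * S * V = (Sᵀ * U)ᵀ * V := by rw [transpose_mul, transpose_transpose]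
  rw [← trace_conj_diagonal_mul_sign hW ν, ← hS, ← h, trace_sub_mul_conj_diagonal hU hV, hR]
  rw [← sum_sum_sq_mul_left hSU hV (fun i => |a i| ^ (1 - q)),
    ← sum_sum_sq_mul_right hSU hV (fun i => |b i| ^ (1 - q))]
  have hD : 2 / q * ∑ i, ∑ j, (Uᵀ * V) i j ^ 2 * bregmanRpow q (a i) (b j) =
      ∑ p : ι × ι, 2 / q * ((Uᵀ * V) p.1 p.2 ^ 2 * bregmanRpow q (a p.1) (b p.2)) := by
    rw [← Finset.mul_sum, Fintype.sum_prod_type]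
  rw [hD]
  simp only [← Finset.sum_add_distrib, ← Fintype.sum_prod_type']
  refine Finset.sum_sq_le_sum_mul_sum_of_sq_le_mul _ (fun p _ => ?_) (fun p _ => ?_) fun p _ => ?_
  · have := bregmanRpow_nonneg hq0 hq1 (a p.1) (b p.2)
    positivity
  · positivity
  · have := mul_le_mul_of_nonneg_left (sq_sub_le_bregmanRpow_mul hq0 hq1 (a p.1) (b p.2))
      (mul_nonneg (sq_nonneg ((Uᵀ * V) p.1 p.2)) (sq_nonneg (((Sᵀ * U)ᵀ * V) p.1 p.2)))
    refine le_trans (le_of_eq ?_) (this.trans (le_of_eq ?_)) <;> ring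

/-- Lower bound of the Bregman divergence by the squared spectral norm of the difference. -/
lemma sq_le_bregman {q : ℝ} (hq0 : 0 < q) (hq1 : q < 1)
    (hU : U ∈ orthogonalGroup ι ℝ) (hV : V ∈ orthogonalGroup ι ℝ) (hW : W ∈ orthogonalGroup ι ℝ)
    {a b ν : ι → ℝ} (h : U * diagonal a * Uᵀ - V * diagonal b * Vᵀ = W * diagonal ν * Wᵀ)
    (ha : ∀ i, |a i| ≤ 1) (hb : ∀ i, |b i| ≤ 1) (l : ι) :
    ν l ^ 2 ≤ 2 / q * ∑ i, ∑ j, (Uᵀ * V) i j ^ 2 * bregmanRpow q (a i) (b j) := by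
  calc ν l ^ 2 ≤ ∑ i, ν i ^ 2 :=
        Finset.single_le_sum (f := fun i => ν i ^ 2) (fun i _ => sq_nonneg _) (Finset.mem_univ l)
    _ = ∑ i, ∑ j, (Uᵀ * V) i j ^ 2 * (a i - b j) ^ 2 := by
        rw [← trace_sq_sub_conj_diagonal hU hV, h, trace_conj_diagonal_mul_self hW]
        simp only [sq]
    _ ≤ ∑ i, ∑ j, 2 / q * ((Uᵀ * V) i j ^ 2 * bregmanRpow q (a i) (b j)) := by
        refine Finset.sum_le_sum fun i _ => Finset.sum_le_sum fun j _ => ?_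
        have := mul_le_mul_of_nonneg_left (sq_sub_le_bregmanRpow hq0 hq1 (ha i) (hb j))
          (sq_nonneg ((Uᵀ * V) i j))
        linarith
    _ = _ := by simp only [Finset.mul_sum]

lemma trace_conj_diagonal_mul_le_sum_abs (hU : U ∈ orthogonalGroup ι ℝ)
    (hV : V ∈ orthogonalGroup ι ℝ) (a : ι → ℝ) {s : ι → ℝ} (hs : ∀ j, |s j| ≤ 1) :
    trace (U * diagonal a * Uᵀ * (V * diagonal s * Vᵀ)) ≤ ∑ i, |a i| := by
  rw [trace_conj_diagonal_mul_conj_diagonal hV, ← sum_sum_sq_mul_left hU hV (fun i => |a i|)]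
  refine Finset.sum_le_sum fun i _ => Finset.sum_le_sum fun j _ => ?_
  refine mul_le_mul_of_nonneg_left ((le_abs_self _).trans ?_) (sq_nonneg _)
  rw [abs_mul]
  exact mul_le_of_le_one_right (abs_nonneg _) (hs j)

lemma abs_trace_conj_diagonal_mul_single_le (hU : U ∈ orthogonalGroup ι ℝ)
    (hV : V ∈ orthogonalGroup ι ℝ) {a : ι → ℝ} {r : ℝ} (ha : ∀ i, |a i| ≤ r) (l : ι) :
    |trace (U * diagonal a * Uᵀ * (V * diagonal (Pi.single l 1) * Vᵀ))| ≤ r := by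
  rw [trace_conj_diagonal_mul_conj_diagonal hV]
  calc _ = |∑ i, (Uᵀ * V) i l ^ 2 * a i| := by
        congr 1
        refine Finset.sum_congr rfl fun i _ => ?_
        rw [Finset.sum_eq_single l] <;> simp +contextual
    _ ≤ ∑ i, |(Uᵀ * V) i l ^ 2 * a i| := Finset.abs_sum_le_sum_abs _ _
    _ ≤ ∑ i, (Uᵀ * V) i l ^ 2 * r := by
        refine Finset.sum_le_sum fun i _ => ?_
        rw [abs_mul, abs_of_nonneg (sq_nonneg _)]
        exact mul_le_mul_of_nonneg_left (ha i) (sq_nonneg _)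
    _ = r := by
        rw [← Finset.sum_mul,
          sum_sq_col_of_mem_orthogonalGroup (transpose_mul_mem_orthogonalGroup hU hV), one_mul]

/-- Convexity of the trace norm, in terms of diagonalizations. -/
lemma sum_abs_convex_comb_le (hU : U ∈ orthogonalGroup ι ℝ) (hV : V ∈ orthogonalGroup ι ℝ)
    (hW : W ∈ orthogonalGroup ι ℝ) {a b c : ι → ℝ} {t K : ℝ} (ht0 : 0 ≤ t) (ht1 : t ≤ 1)
    (h : W * diagonal c * Wᵀ = t • (U * diagonal a * Uᵀ) + (1 - t) • (V * diagonal b * Vᵀ))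
    (ha : ∑ i, |a i| ≤ K) (hb : ∑ i, |b i| ≤ K) : ∑ i, |c i| ≤ K := by
  rw [← trace_conj_diagonal_mul_sign hW c, h, Matrix.add_mul, trace_add, Matrix.smul_mul,
    Matrix.smul_mul, trace_smul, trace_smul, smul_eq_mul, smul_eq_mul]
  have hs : ∀ j, |if 0 ≤ c j then (1 : ℝ) else -1| ≤ 1 := fun j => by split_ifs <;> simp
  have h1 := (trace_conj_diagonal_mul_le_sum_abs hU hW a hs).trans ha
  have h2 := (trace_conj_diagonal_mul_le_sum_abs hV hW b hs).trans hb
  nlinarith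

/-- Convexity of the spectral norm, in terms of diagonalizations. -/
lemma abs_convex_comb_le (hU : U ∈ orthogonalGroup ι ℝ) (hV : V ∈ orthogonalGroup ι ℝ)
    (hW : W ∈ orthogonalGroup ι ℝ) {a b c : ι → ℝ} {t r : ℝ} (ht0 : 0 ≤ t) (ht1 : t ≤ 1)
    (h : W * diagonal c * Wᵀ = t • (U * diagonal a * Uᵀ) + (1 - t) • (V * diagonal b * Vᵀ))
    (ha : ∀ i, |a i| ≤ r) (hb : ∀ i, |b i| ≤ r) (l : ι) : |c l| ≤ r := by
  have hc : c l = trace (W * diagonal c * Wᵀ * (W * diagonal (Pi.single l 1) * Wᵀ)) := by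
    rw [trace_conj_diagonal_mul_self hW]
    simp [Pi.single_apply]
  have h1 := abs_trace_conj_diagonal_mul_single_le hU hW ha l
  have h2 := abs_trace_conj_diagonal_mul_single_le hV hW hb l
  rw [hc, h, Matrix.add_mul, trace_add, Matrix.smul_mul, Matrix.smul_mul, trace_smul, trace_smul,
    smul_eq_mul, smul_eq_mul]
  rw [abs_le] at h1 h2 ⊢
  constructor <;> nlinarith

end OrthogonalDiagonalization

/-! ### Differentiability from a continuous subgradient -/

/-- A function with a continuous selection of subgradients is continuously differentiable. -/
lemma contDiff_one_of_continuous_subgradient {E : Type*} [NormedAddCommGroup E] [NormedSpace ℝ E]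
    {g : E → ℝ} {L : E → E →L[ℝ] ℝ} (hL : Continuous L)
    (hsub : ∀ u v, g v + L v (u - v) ≤ g u) : ContDiff ℝ 1 g := by
  refine contDiff_one_iff_hasFDerivAt.2 ⟨L, hL, fun v => ?_⟩
  rw [hasFDerivAt_iff_isLittleO, Asymptotics.isLittleO_iff]
  intro c hc
  filter_upwards [Metric.tendsto_nhds.1 (hL.tendsto v) c hc] with u hu
  have h1 := hsub u v
  have h2 := hsub v u
  have h3 : L u (v - u) = -(L u (u - v)) := by rw [← map_neg, neg_sub]
  have h4 : (L u - L v) (u - v) ≤ ‖L u - L v‖ * ‖u - v‖ :=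
    (le_abs_self _).trans ((L u - L v).le_opNorm (u - v))
  rw [_root_.sub_apply] at h4
  have h5 : ‖L u - L v‖ * ‖u - v‖ ≤ c * ‖u - v‖ := by
    rw [dist_eq_norm] at hu
    gcongr
  rw [Real.norm_eq_abs, abs_of_nonneg (by linarith)]
  linarith

/-! ### The spectral function on symmetric matrices -/

section SpectralFunction

variable {ι : Type*} [Fintype ι] [DecidableEq ι]

namespace Matrix.IsHermitian

lemma eigenvectorUnitary_mem_orthogonalGroup {y : Matrix ι ι ℝ} (h : y.IsHermitian) :
    (h.eigenvectorUnitary : Matrix ι ι ℝ) ∈ orthogonalGroup ι ℝ :=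
  h.eigenvectorUnitary.2

lemma eq_conj_diagonal_eigenvalues {y : Matrix ι ι ℝ} (h : y.IsHermitian) :
    y = (h.eigenvectorUnitary : Matrix ι ι ℝ) * diagonal h.eigenvalues *
      (h.eigenvectorUnitary : Matrix ι ι ℝ)ᵀ := by
  conv_lhs => rw [h.spectral_theorem]
  simp [Unitary.conjStarAlgAut_apply, star_eq_conjTranspose]

/-- The subgradient at `y` of the spectral function `∑ |λ| ^ (1 + q) / (1 + q)`. -/
noncomputable def spectralGradient (q : ℝ) {y : Matrix ι ι ℝ} (h : y.IsHermitian) :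
    Matrix ι ι ℝ :=
  (h.eigenvectorUnitary : Matrix ι ι ℝ) * diagonal (fun j => signedRpow q (h.eigenvalues j)) *
    (h.eigenvectorUnitary : Matrix ι ι ℝ)ᵀ

lemma spectralGradient_isHermitian (q : ℝ) {y : Matrix ι ι ℝ} (h : y.IsHermitian) :
    (h.spectralGradient q).IsHermitian := by
  simp [IsHermitian, spectralGradient, Matrix.mul_assoc]

lemma bregman_eq {u v : Matrix ι ι ℝ} (hu : u.IsHermitian) (hv : v.IsHermitian) (q : ℝ) :
    ∑ i, ∑ j, ((hu.eigenvectorUnitary : Matrix ι ι ℝ)ᵀ * hv.eigenvectorUnitary) i j ^ 2 *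
        bregmanRpow q (hu.eigenvalues i) (hv.eigenvalues j) =
      1 / (1 + q) * ∑ i, |hu.eigenvalues i| ^ (1 + q) -
        1 / (1 + q) * ∑ j, |hv.eigenvalues j| ^ (1 + q) -
        trace ((u - v) * hv.spectralGradient q) := by
  rw [sum_sum_sq_mul_bregmanRpow hu.eigenvectorUnitary_mem_orthogonalGroup
    hv.eigenvectorUnitary_mem_orthogonalGroup, ← hu.eq_conj_diagonal_eigenvalues,
    ← hv.eq_conj_diagonal_eigenvalues, spectralGradient]

lemma add_trace_spectralGradient_le {u v : Matrix ι ι ℝ} (hu : u.IsHermitian)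
    (hv : v.IsHermitian) {q : ℝ} (hq0 : 0 < q) (hq1 : q < 1) :
    1 / (1 + q) * ∑ j, |hv.eigenvalues j| ^ (1 + q) + trace ((u - v) * hv.spectralGradient q) ≤
      1 / (1 + q) * ∑ i, |hu.eigenvalues i| ^ (1 + q) := by
  have h := hu.bregman_eq hv q
  have : 0 ≤ ∑ i, ∑ j, ((hu.eigenvectorUnitary : Matrix ι ι ℝ)ᵀ * hv.eigenvectorUnitary) i j ^ 2 *
        bregmanRpow q (hu.eigenvalues i) (hv.eigenvalues j) :=
    Finset.sum_nonneg fun i _ => Finset.sum_nonneg fun j _ =>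
      mul_nonneg (sq_nonneg _) (bregmanRpow_nonneg hq0 hq1 _ _)
  linarith

lemma frobenius_norm_sq_eq_trace {κ : Type*} [Fintype κ] {y : Matrix κ κ ℝ} (h : y.IsHermitian) :
    ‖y‖ ^ 2 = trace (y * y) := by
  rw [frobenius_norm_def, ← Real.rpow_natCast, ← Real.rpow_mul (by positivity)]
  norm_num
  have : y * y = y * yᵀ := by
    rw [← conjTranspose_eq_transpose_of_trivial, h.eq]
  rw [this]
  simp [trace, Matrix.mul_apply, sq]

lemma norm_spectralGradient_sub_sq_le {u v : Matrix ι ι ℝ} (hu : u.IsHermitian)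
    (hv : v.IsHermitian) {q : ℝ} (hq0 : 0 < q) (hq1 : q < 1) :
    ‖hu.spectralGradient q - hv.spectralGradient q‖ ^ 2 ≤
      (Fintype.card ι : ℝ) ^ 2 * 4 * (‖u - v‖ ^ 2) ^ q := by
  rw [((hu.spectralGradient_isHermitian q).sub
    (hv.spectralGradient_isHermitian q)).frobenius_norm_sq_eq_trace,
    (hu.sub hv).frobenius_norm_sq_eq_trace]
  have hU := hu.eigenvectorUnitary_mem_orthogonalGroup
  have hV := hv.eigenvectorUnitary_mem_orthogonalGroup
  have hT := trace_sq_sub_conj_diagonal hU hV hu.eigenvalues hv.eigenvalues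
  rw [← hu.eq_conj_diagonal_eigenvalues, ← hv.eq_conj_diagonal_eigenvalues] at hT
  rw [spectralGradient, spectralGradient, trace_sq_sub_conj_diagonal hU hV, hT]
  set C := (hu.eigenvectorUnitary : Matrix ι ι ℝ)ᵀ * (hv.eigenvectorUnitary : Matrix ι ι ℝ)
    with hC
  have hCmem : C ∈ orthogonalGroup ι ℝ := transpose_mul_mem_orthogonalGroup hU hV
  set T := ∑ i, ∑ j, C i j ^ 2 * (hu.eigenvalues i - hv.eigenvalues j) ^ 2 with hTdef
  have hentry : ∀ i j, C i j ^ 2 *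
      (signedRpow q (hu.eigenvalues i) - signedRpow q (hv.eigenvalues j)) ^ 2 ≤ 4 * T ^ q := by
    intro i j
    set d := hu.eigenvalues i - hv.eigenvalues j with hd
    have h1 := abs_signedRpow_sub_le hq0 hq1 (hu.eigenvalues i) (hv.eigenvalues j)
    have h2 : (signedRpow q (hu.eigenvalues i) - signedRpow q (hv.eigenvalues j)) ^ 2 ≤
        4 * (d ^ 2) ^ q := by
      have h3 : (d ^ 2) ^ q = (|d| ^ q) ^ 2 := by
        rw [← sq_abs, ← Real.rpow_natCast, ← Real.rpow_natCast, ← Real.rpow_mul (abs_nonneg _),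
          ← Real.rpow_mul (abs_nonneg _), mul_comm]
      rw [h3, ← sq_abs]
      nlinarith [abs_nonneg (signedRpow q (hu.eigenvalues i) - signedRpow q (hv.eigenvalues j))]
    have hC1 : C i j ^ 2 ≤ 1 := by
      rw [← sum_sq_row_of_mem_orthogonalGroup hCmem i]
      exact Finset.single_le_sum (f := fun j => C i j ^ 2) (fun j _ => sq_nonneg _)
        (Finset.mem_univ j)
    have hCq : C i j ^ 2 ≤ (C i j ^ 2) ^ q := by
      rcases (sq_nonneg (C i j)).eq_or_lt with h0 | h0
      · rw [← h0]
        positivity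
      · simpa using Real.rpow_le_rpow_of_exponent_ge h0 hC1 hq1.le
    have hle : C i j ^ 2 * d ^ 2 ≤ T := by
      refine le_trans ?_ (Finset.single_le_sum (f := fun i => ∑ j, C i j ^ 2 *
        (hu.eigenvalues i - hv.eigenvalues j) ^ 2)
        (fun i _ => Finset.sum_nonneg fun j _ => by positivity) (Finset.mem_univ i))
      exact Finset.single_le_sum (f := fun j => C i j ^ 2 *
        (hu.eigenvalues i - hv.eigenvalues j) ^ 2) (fun j _ => by positivity) (Finset.mem_univ j)
    calc _ ≤ (C i j ^ 2) ^ q * (4 * (d ^ 2) ^ q) := by gcongr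
      _ = 4 * (C i j ^ 2 * d ^ 2) ^ q := by
          rw [Real.mul_rpow (sq_nonneg _) (sq_nonneg _)]
          ring
      _ ≤ 4 * T ^ q := by gcongr
  calc _ ≤ ∑ _i : ι, ∑ _j : ι, 4 * T ^ q :=
        Finset.sum_le_sum fun i _ => Finset.sum_le_sum fun j _ => hentry i j
    _ = _ := by
        simp only [Finset.sum_const, Finset.card_univ, nsmul_eq_mul]
        ring

end Matrix.IsHermitian

/-- The symmetric part of a square matrix, as a linear map. -/
noncomputable def symmPart (ι : Type*) : Matrix ι ι ℝ →ₗ[ℝ] Matrix ι ι ℝ :=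
  (1 / 2 : ℝ) • (LinearMap.id + (transposeLinearEquiv ι ι ℝ ℝ).toLinearMap)

lemma symmPart_apply {κ : Type*} (y : Matrix κ κ ℝ) : symmPart κ y = (1 / 2 : ℝ) • (y + yᵀ) := rfl

lemma symmPart_isHermitian {κ : Type*} (y : Matrix κ κ ℝ) : (symmPart κ y).IsHermitian := by
  rw [symmPart_apply, IsHermitian, conjTranspose_eq_transpose_of_trivial, transpose_smul,
    transpose_add, transpose_transpose, add_comm]

lemma symmPart_eq_self {κ : Type*} {y : Matrix κ κ ℝ} (h : y.IsHermitian) : symmPart κ y = y := by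
  rw [symmPart_apply, ← conjTranspose_eq_transpose_of_trivial, h.eq, ← two_smul ℝ y, smul_smul]
  norm_num

/-- The trace pairing against the symmetric part, as a continuous linear functional. -/
noncomputable def symmTracePairing (ι : Type*) [Fintype ι] [DecidableEq ι] :
    Matrix ι ι ℝ →ₗ[ℝ] (Matrix ι ι ℝ →L[ℝ] ℝ) :=
  LinearMap.toContinuousLinearMap.toLinearMap ∘ₗ
    (((LinearMap.mul ℝ (Matrix ι ι ℝ)).flip.compr₂ (traceLinearMap ι ℝ ℝ)).compl₂ (symmPart ι))

lemma symmTracePairing_apply (x y : Matrix ι ι ℝ) :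
    symmTracePairing ι x y = trace (symmPart ι y * x) := rfl

lemma continuous_spectralGradient_symmPart {q : ℝ} (hq0 : 0 < q) (hq1 : q < 1) :
    Continuous fun y : Matrix ι ι ℝ => (symmPart_isHermitian y).spectralGradient q := by
  have hS : Continuous (symmPart ι) := (symmPart ι).continuous_of_finiteDimensional
  refine continuous_iff_continuousAt.2 fun v => tendsto_iff_norm_sub_tendsto_zero.2 ?_
  have hbound : Continuous fun u : Matrix ι ι ℝ =>
      √((Fintype.card ι : ℝ) ^ 2 * 4 * (‖symmPart ι u - symmPart ι v‖ ^ 2) ^ q) :=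
    Real.continuous_sqrt.comp (continuous_const.mul
      ((Real.continuous_rpow_const hq0.le).comp ((hS.sub continuous_const).norm.pow 2)))
  have hlim := hbound.tendsto v
  simp only [sub_self, norm_zero, ne_eq, OfNat.ofNat_ne_zero, not_false_eq_true, zero_pow,
    Real.zero_rpow hq0.ne', mul_zero, Real.sqrt_zero] at hlim
  refine squeeze_zero (fun _ => norm_nonneg _) (fun u => ?_) hlim
  exact Real.le_sqrt_of_sq_le ((symmPart_isHermitian u).norm_spectralGradient_sub_sq_le
    (symmPart_isHermitian v) hq0 hq1)

/-- The spectral function of the symmetric part is continuously differentiable. -/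
lemma contDiff_spectral_symmPart {q : ℝ} (hq0 : 0 < q) (hq1 : q < 1) :
    ContDiff ℝ 1 fun y : Matrix ι ι ℝ =>
      1 / (1 + q) * ∑ j, |(symmPart_isHermitian y).eigenvalues j| ^ (1 + q) := by
  refine contDiff_one_of_continuous_subgradient
    (L := fun y => symmTracePairing ι ((symmPart_isHermitian y).spectralGradient q))
    ((symmTracePairing ι).continuous_of_finiteDimensional.comp
      (continuous_spectralGradient_symmPart hq0 hq1)) fun u v => ?_
  have h := (symmPart_isHermitian u).add_trace_spectralGradient_le (symmPart_isHermitian v) hq0 hq1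
  rw [← map_sub, ← symmTracePairing_apply] at h
  exact h

end SpectralFunction

/-- The Bregman divergence of the spectral function dominates the squared norm
`max (‖λ‖_∞, ‖λ‖_1 / K)` of the difference. -/
lemma max_sq_le_bregman {ι : Type*} [Fintype ι] [DecidableEq ι] [Nonempty ι]
    {U V W : Matrix ι ι ℝ} {q N K c : ℝ} (hq0 : 0 < q) (hq1 : q < 1) (hN : 0 < N) (hK : 0 < K)
    (hU : U ∈ orthogonalGroup ι ℝ) (hV : V ∈ orthogonalGroup ι ℝ) (hW : W ∈ orthogonalGroup ι ℝ)
    {a b ν : ι → ℝ} (h : U * diagonal a * Uᵀ - V * diagonal b * Vᵀ = c • (W * diagonal ν * Wᵀ))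
    (ha : ∀ i, |a i| ≤ 1) (hb : ∀ i, |b i| ≤ 1) (ha' : ∑ i, |a i| ≤ K) (hb' : ∑ i, |b i| ≤ K)
    (hac : ((Finset.univ.filter fun i => a i ≠ 0).card : ℝ) ≤ N)
    (hbc : ((Finset.univ.filter fun i => b i ≠ 0).card : ℝ) ≤ N) :
    q * min 1 ((1 / 2) * K ^ (1 + q) * N ^ (-q)) / 2 * c ^ 2 *
        max (⨆ i, |ν i|) ((∑ i, |ν i|) / K) ^ 2 ≤
      ∑ i, ∑ j, (Uᵀ * V) i j ^ 2 * bregmanRpow q (a i) (b j) := by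
  have hh : U * diagonal a * Uᵀ - V * diagonal b * Vᵀ = W * diagonal (c • ν) * Wᵀ := by
    rw [h, diagonal_smul, Matrix.mul_smul, Matrix.smul_mul]
  set D := ∑ i, ∑ j, (Uᵀ * V) i j ^ 2 * bregmanRpow q (a i) (b j) with hD
  rcases max_choice (⨆ i, |ν i|) ((∑ i, |ν i|) / K) with hmax | hmax <;> rw [hmax]
  · obtain ⟨l, hl⟩ := exists_eq_ciSup_of_finite (f := fun i => |ν i|)
    have h1 := sq_le_bregman hq0 hq1 hU hV hW hh ha hb l
    rw [← hD, Pi.smul_apply, smul_eq_mul, mul_pow, div_mul_eq_mul_div, le_div_iff₀ hq0] at h1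
    rw [← hl, sq_abs]
    calc _ ≤ q * 1 / 2 * c ^ 2 * ν l ^ 2 := by
          gcongr
          exact min_le_left _ _
      _ ≤ D := by linarith
  · have h1 := sq_sum_abs_le_bregman hq0 hq1 hU hV hW hh
    have h2 := sum_abs_rpow_one_sub_le hq0 hq1 hN hK a hac ha'
    have h3 := sum_abs_rpow_one_sub_le hq0 hq1 hN hK b hbc hb'
    have hD0 : 0 ≤ D := Finset.sum_nonneg fun i _ => Finset.sum_nonneg fun j _ =>
      mul_nonneg (sq_nonneg _) (bregmanRpow_nonneg hq0 hq1 _ _)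
    have h4 : c ^ 2 * (∑ i, |ν i|) ^ 2 ≤ 2 / q * D * (2 * (N ^ q * K ^ (1 - q))) := by
      have e : ∑ i, |(c • ν) i| = |c| * ∑ i, |ν i| := by
        simp [Finset.mul_sum, abs_mul]
      rw [e, mul_pow, sq_abs] at h1
      refine h1.trans ?_
      gcongr
      linarith
    calc _ ≤ q * ((1 / 2) * K ^ (1 + q) * N ^ (-q)) / 2 * c ^ 2 * ((∑ i, |ν i|) / K) ^ 2 := by
          gcongr
          exact min_le_right _ _
      _ = q * ((1 / 2) * K ^ (1 + q) * N ^ (-q)) / 2 / K ^ 2 * (c ^ 2 * (∑ i, |ν i|) ^ 2) := by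
          ring
      _ ≤ q * ((1 / 2) * K ^ (1 + q) * N ^ (-q)) / 2 / K ^ 2 *
            (2 / q * D * (2 * (N ^ q * K ^ (1 - q)))) := by gcongr
      _ = D := by
          rw [Real.rpow_neg hN.le, Real.rpow_add hK, Real.rpow_sub hK, Real.rpow_one]
          field_simp

/-- Let `m ≥ n ≥ k ≥ 1`, `F` a linear subspace of `S^m` all of whose members
have at most `n` nonzero eigenvalues, `q ∈ (0,1)`, and
`χ(y) = (1/(1+q))·Σ_j |λ_j(y)|^{1+q}`. Then `χ` is continuously differentiable and convex on
`S^m`, and its restriction to `Y^k_F = {y ∈ F : ‖λ(y)‖_∞ ≤ 1, ‖λ(y)‖_1 ≤ k}` is strongly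
convex, modulus `β = q·min(1, ½ k^{1+q} n^{−q})`, w.r.t. the norm
`‖y‖_{(k)} = max(‖λ(y)‖_∞, ‖λ(y)‖_1/k)`. -/
theorem stmt_9 (m n k : ℕ) (hk : 1 ≤ k) (hkn : k ≤ n) (hnm : n ≤ m)
    (Fs : Submodule ℝ (Matrix (Fin m) (Fin m) ℝ))
    (hFsym : ∀ y ∈ Fs, y.IsHermitian)
    (eig : Matrix (Fin m) (Fin m) ℝ → Fin m → ℝ)
    (heig : ∀ (y : Matrix (Fin m) (Fin m) ℝ) (h : y.IsHermitian), eig y = h.eigenvalues)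
    (hrank : ∀ y ∈ Fs, (Finset.univ.filter fun j => eig y j ≠ 0).card ≤ n)
    (q : ℝ) (hq0 : 0 < q) (hq1 : q < 1)
    (χ : Matrix (Fin m) (Fin m) ℝ → ℝ)
    (hχ : χ = fun y => (1 / (1 + q)) * ∑ j, |eig y j| ^ (1 + q))
    (β : ℝ) (hβ : β = q * min 1 ((1 / 2) * (k : ℝ) ^ (1 + q) * (n : ℝ) ^ (-q)))
    (Nk : Matrix (Fin m) (Fin m) ℝ → ℝ)
    (hNk : Nk = fun y => max (⨆ j, |eig y j|) ((∑ j, |eig y j|) / k))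
    (YkF : Set (Matrix (Fin m) (Fin m) ℝ))
    (hYkF : YkF = {y | y ∈ Fs ∧ (⨆ j, |eig y j|) ≤ 1 ∧ ∑ j, |eig y j| ≤ (k : ℝ)}) :
    ContDiffOn ℝ 1 χ {y | y.IsHermitian} ∧
    ConvexOn ℝ {y : Matrix (Fin m) (Fin m) ℝ | y.IsHermitian} χ ∧
    ∀ u ∈ YkF, ∀ v ∈ YkF, ∀ t ∈ Set.Icc (0 : ℝ) 1,
      χ (t • u + (1 - t) • v) ≤
        t * χ u + (1 - t) * χ v - (β / 2) * t * (1 - t) * Nk (u - v) ^ 2 := by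
  have hm : Nonempty (Fin m) := ⟨⟨0, by omega⟩⟩
  have hK : (0 : ℝ) < k := by exact_mod_cast hk
  have hN : (0 : ℝ) < n := by exact_mod_cast hk.trans hkn
  have hχy : ∀ (y : Matrix (Fin m) (Fin m) ℝ) (h : y.IsHermitian),
      χ y = 1 / (1 + q) * ∑ j, |h.eigenvalues j| ^ (1 + q) := fun y h => by
    simp only [hχ, heig y h]
  have hcomb : ∀ u v : Matrix (Fin m) (Fin m) ℝ, u.IsHermitian → v.IsHermitian → ∀ s t : ℝ,
      (s • u + t • v).IsHermitian := fun u v hu hv s t => by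
    rw [IsHermitian, conjTranspose_add, conjTranspose_smul, conjTranspose_smul, hu.eq, hv.eq,
      star_trivial, star_trivial]
  refine ⟨?_, ?_, ?_⟩
  · refine (contDiff_spectral_symmPart (ι := Fin m) hq0 hq1).contDiffOn.congr fun y hy => ?_
    rw [← hχy _ (symmPart_isHermitian y), symmPart_eq_self hy]
  · refine ⟨fun u hu v hv s t _ _ _ => hcomb u v hu hv s t, ?_⟩
    intro u hu v hv s t hs ht hst
    have hz := hcomb u v hu hv s t
    have h1 := hu.add_trace_spectralGradient_le hz hq0 hq1
    have h2 := hv.add_trace_spectralGradient_le hz hq0 hq1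
    rw [← hχy _ hu, ← hχy _ hz] at h1
    rw [← hχy _ hv, ← hχy _ hz] at h2
    have e1 : u - (s • u + t • v) = t • (u - v) := by
      rw [← eq_sub_iff_add_eq'] at hst
      rw [hst]
      module
    have e2 : v - (s • u + t • v) = (-s) • (u - v) := by
      rw [← eq_sub_iff_add_eq'] at hst
      rw [hst]
      module
    rw [e1, Matrix.smul_mul, trace_smul, smul_eq_mul] at h1
    rw [e2, Matrix.smul_mul, trace_smul, smul_eq_mul] at h2
    have h3 := mul_le_mul_of_nonneg_left h1 hs
    have h4 := mul_le_mul_of_nonneg_left h2 ht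
    have h5 : (s + t) * χ (s • u + t • v) = χ (s • u + t • v) := by rw [hst, one_mul]
    rw [smul_eq_mul, smul_eq_mul]
    linarith
  · rw [hYkF]
    rintro u ⟨huF, husup, husum⟩ v ⟨hvF, hvsup, hvsum⟩ t ⟨ht0, ht1⟩
    have hzF : t • u + (1 - t) • v ∈ Fs := Fs.add_mem (Fs.smul_mem t huF) (Fs.smul_mem (1 - t) hvF)
    have hwF : u - v ∈ Fs := Fs.sub_mem huF hvF
    have hu := hFsym u huF
    have hv := hFsym v hvF
    have hw := hFsym _ hwF
    have hz := hFsym _ hzF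
    have hur := hrank u huF
    have hvr := hrank v hvF
    have hzr := hrank _ hzF
    rw [heig u hu] at hur husup husum
    rw [heig v hv] at hvr hvsup hvsum
    rw [heig _ hz] at hzr
    have hu1 : ∀ i, |hu.eigenvalues i| ≤ 1 := fun i =>
      (le_ciSup (f := fun j => |hu.eigenvalues j|) (Set.finite_range _).bddAbove i).trans husup
    have hv1 : ∀ i, |hv.eigenvalues i| ≤ 1 := fun i =>
      (le_ciSup (f := fun j => |hv.eigenvalues j|) (Set.finite_range _).bddAbove i).trans hvsup
    have hU := hu.eigenvectorUnitary_mem_orthogonalGroup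
    have hV := hv.eigenvectorUnitary_mem_orthogonalGroup
    have hZ := hz.eigenvectorUnitary_mem_orthogonalGroup
    have hW := hw.eigenvectorUnitary_mem_orthogonalGroup
    have hzeq := hz.eq_conj_diagonal_eigenvalues.symm
    conv_rhs at hzeq => rw [hu.eq_conj_diagonal_eigenvalues, hv.eq_conj_diagonal_eigenvalues]
    have hz1 := abs_convex_comb_le hU hV hZ ht0 ht1 hzeq hu1 hv1
    have hzsum := sum_abs_convex_comb_le hU hV hZ ht0 ht1 hzeq husum hvsum
    have e1 : u - (t • u + (1 - t) • v) = (1 - t) • (u - v) := by module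
    have e2 : v - (t • u + (1 - t) • v) = (-t) • (u - v) := by module
    have d1 := max_sq_le_bregman (c := 1 - t) hq0 hq1 hN hK hU hZ hW
      (by rw [← hu.eq_conj_diagonal_eigenvalues, ← hz.eq_conj_diagonal_eigenvalues,
            ← hw.eq_conj_diagonal_eigenvalues, e1])
      hu1 hz1 husum hzsum (by exact_mod_cast hur) (by exact_mod_cast hzr)
    have d2 := max_sq_le_bregman (c := -t) hq0 hq1 hN hK hV hZ hW
      (by rw [← hv.eq_conj_diagonal_eigenvalues, ← hz.eq_conj_diagonal_eigenvalues,
            ← hw.eq_conj_diagonal_eigenvalues, e2])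
      hv1 hz1 hvsum hzsum (by exact_mod_cast hvr) (by exact_mod_cast hzr)
    have hNkw : Nk (u - v) =
        max (⨆ i, |hw.eigenvalues i|) ((∑ i, |hw.eigenvalues i|) / k) := by
      simp only [hNk, heig _ hw]
    rw [hu.bregman_eq hz, ← hχy _ hu, ← hχy _ hz, ← hβ, ← hNkw, e1, Matrix.smul_mul, trace_smul,
      smul_eq_mul] at d1
    rw [hv.bregman_eq hz, ← hχy _ hv, ← hχy _ hz, ← hβ, ← hNkw, e2, Matrix.smul_mul, trace_smul,
      smul_eq_mul] at d2
    have h3 := mul_le_mul_of_nonneg_left d1 ht0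
    have h4 := mul_le_mul_of_nonneg_left d2 (sub_nonneg.2 ht1)
    linarith
end

section
/- Let m ≥ 2 and k be integers with 1 ≤ k ≤ m/2. Set q = min(1, ln(k)/ln(m/k)) if k > 1 and q = 1/(2 ln m) if k = 1; set β = 1 if k ≥ √m, β = q/2 if 1 < k < √m, and β = q/(2√e) if k = 1. Let X = {x ∈ S^m : 0 ⪯ x ⪯ I_m, Tr(x) = k} and ω(x) = (4/(β(1+q)))·Σ_{j=1}^m |λ_j(x)|^{1+q}. Then ω is convex and continuously differentiable on S^m, its restriction to X is strongly convex with modulus 1 w.r.t. the norm ‖·‖_X on {x ∈ S^m : Tr(x) = 0} whose unit ball is ½[X−X] := {(u−v)/2 : u, v ∈ X}, and Ω_X := √(2(max_X ω − min_X ω)) ≤ 2·√(2k/(β(1+q))). -/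
open Matrix Pointwise

attribute [local instance] Matrix.frobeniusNormedAddCommGroup Matrix.frobeniusNormedSpace

/-- A function on a linear subspace `S`, with subgradients depending Hölder continuously on the base
point, is continuously differentiable on `S`. -/
theorem contDiffOn_of_hoelder_subgradient {E : Type*} [NormedAddCommGroup E] [NormedSpace ℝ E]
    [FiniteDimensional ℝ E] {S : Set E} (T : E →ₗ[ℝ] E) (hT : ∀ x, T x ∈ S) (hTS : ∀ x ∈ S, T x = x)
    (f : E → ℝ) (L : E → E →ₗ[ℝ] ℝ) {C q : ℝ} (hq : 0 < q)
    (hsub : ∀ x ∈ S, ∀ y ∈ S, L x (y - x) ≤ f y - f x)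
    (hL : ∀ x ∈ S, ∀ y ∈ S, ∀ h, |L y h - L x h| ≤ C * ‖y - x‖ ^ q * ‖h‖) :
    ContDiffOn ℝ 1 f S := by
  set T' : E →L[ℝ] E := LinearMap.toContinuousLinearMap T
  have hT' : ∀ x, T' x = T x := fun x => rfl
  have hzero : ∀ x, Filter.Tendsto (fun y => |C| * ‖T' y - T' x‖ ^ q * ‖T'‖) (nhds x) (nhds 0) := by
    intro x
    have : Continuous (fun y => |C| * ‖T' y - T' x‖ ^ q * ‖T'‖) :=
      (continuous_const.mul ((T'.continuous.sub continuous_const).norm.rpow_const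
        fun _ => Or.inr hq.le)).mul continuous_const
    simpa [Real.zero_rpow hq.ne'] using this.tendsto x
  have hbound : ∀ x y h, |L (T y) (T h) - L (T x) (T h)| ≤ |C| * ‖T' y - T' x‖ ^ q * ‖T'‖ * ‖h‖ := by
    intro x y h
    calc _ ≤ C * ‖T y - T x‖ ^ q * ‖T h‖ := hL _ (hT x) _ (hT y) _
      _ ≤ |C| * ‖T y - T x‖ ^ q * (‖T'‖ * ‖h‖) := by
        gcongr
        · exact le_abs_self C
        · exact T'.le_opNorm h
      _ = _ := by rw [← mul_assoc]; rfl
  have hF : ContDiff ℝ 1 (fun x => f (T x)) := by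
    rw [contDiff_one_iff_hasFDerivAt]
    refine ⟨fun x => (LinearMap.toContinuousLinearMap (L (T x))).comp T', ?_, ?_⟩
    · rw [continuous_iff_continuousAt]
      intro x
      rw [ContinuousAt, tendsto_iff_norm_sub_tendsto_zero]
      refine squeeze_zero (fun _ => norm_nonneg _) (fun y => ?_) (hzero x)
      refine ContinuousLinearMap.opNorm_le_bound _ (by positivity) fun h => ?_
      exact hbound x y h
    · intro x
      rw [hasFDerivAt_iff_isLittleO, Asymptotics.isLittleO_iff]
      intro c hc
      filter_upwards [(hzero x).eventually (gt_mem_nhds hc)] with y hy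
      have h1 := hsub _ (hT x) _ (hT y)
      have h2 := hsub _ (hT y) _ (hT x)
      have h3 := hbound x y (y - x)
      rw [← neg_sub, map_neg] at h2
      rw [← map_sub] at h1 h2
      change |f (T y) - f (T x) - L (T x) (T (y - x))| ≤ c * ‖y - x‖
      calc _ ≤ |L (T y) (T (y - x)) - L (T x) (T (y - x))| := by
            rw [abs_of_nonneg (by linarith)]
            exact le_trans (by linarith) (le_abs_self _)
        _ ≤ _ := h3
        _ ≤ _ := by gcongr
  exact hF.contDiffOn.congr fun x hx => by simp only [hTS x hx]

/-- A function with a quadratic lower bound along its subgradients is strongly convex. -/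
theorem strongly_convex_of_subgradient {E : Type*} [AddCommGroup E] [Module ℝ E] {S : Set E}
    (hS : Convex ℝ S) (f : E → ℝ) (L : E → E →ₗ[ℝ] ℝ) (N : E → ℝ)
    (hN : ∀ (c : ℝ) (h : E), N (c • h) ^ 2 = c ^ 2 * N h ^ 2)
    (hsub : ∀ x ∈ S, ∀ y ∈ S, L x (y - x) + (1 / 2) * N (y - x) ^ 2 ≤ f y - f x)
    {u v : E} (hu : u ∈ S) (hv : v ∈ S) {t : ℝ} (ht : t ∈ Set.Icc (0 : ℝ) 1) :
    f (t • u + (1 - t) • v) ≤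
      t * f u + (1 - t) * f v - (1 / 2) * t * (1 - t) * N (u - v) ^ 2 := by
  have ht0 := ht.1
  have ht1 : 0 ≤ 1 - t := sub_nonneg.2 ht.2
  set z := t • u + (1 - t) • v with hz
  have hzS : z ∈ S := hS hu hv ht0 ht1 (by ring)
  have h1 := hsub z hzS u hu
  have h2 := hsub z hzS v hv
  have e1 : u - z = (1 - t) • (u - v) := by rw [hz]; module
  have e2 : v - z = (-t) • (u - v) := by rw [hz]; module
  rw [e1, hN, map_smul, smul_eq_mul] at h1
  rw [e2, hN, map_smul, smul_eq_mul] at h2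
  nlinarith [mul_le_mul_of_nonneg_left h1 ht0, mul_le_mul_of_nonneg_left h2 ht1]

/-- The derivative of `s ↦ |s| ^ (1 + q)`. -/
noncomputable def absRpowDeriv (q s : ℝ) : ℝ := (1 + q) * |s| ^ (1 + q - 2) * s

theorem hasDerivAt_abs_rpow_one_add {q : ℝ} (hq : 0 < q) (s : ℝ) :
    HasDerivAt (fun s : ℝ => |s| ^ (1 + q)) (absRpowDeriv q s) s :=
  hasDerivAt_abs_rpow s (by linarith)

theorem absRpowDeriv_of_nonneg {q s : ℝ} (hq : 0 < q) (hs : 0 ≤ s) :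
    absRpowDeriv q s = (1 + q) * s ^ q := by
  rcases hs.eq_or_lt with rfl | hs
  · simp [absRpowDeriv, Real.zero_rpow hq.ne']
  · rw [absRpowDeriv, abs_of_pos hs, mul_assoc, ← Real.rpow_add_one hs.ne']
    ring_nf

theorem absRpowDeriv_neg (q s : ℝ) : absRpowDeriv q (-s) = -absRpowDeriv q s := by
  simp [absRpowDeriv]

theorem abs_rpow_sub_rpow_le_s10 {q a b : ℝ} (hq : 0 < q) (hq1 : q ≤ 1) (ha : 0 ≤ a) (hb : 0 ≤ b) :
    |a ^ q - b ^ q| ≤ |a - b| ^ q := by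
  wlog h : b ≤ a generalizing a b
  · rw [abs_sub_comm, abs_sub_comm a b]
    exact this hb ha (le_of_not_ge h)
  have h1 := Real.rpow_add_le_add_rpow (sub_nonneg.2 h) hb hq.le hq1
  rw [sub_add_cancel] at h1
  rw [abs_of_nonneg (sub_nonneg.2 (Real.rpow_le_rpow hb h hq.le)), abs_of_nonneg (sub_nonneg.2 h)]
  linarith

theorem abs_absRpowDeriv_sub_le {q : ℝ} (hq : 0 < q) (hq1 : q ≤ 1) (a b : ℝ) :
    |absRpowDeriv q a - absRpowDeriv q b| ≤ 4 * |a - b| ^ q := by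
  wlog ha : 0 ≤ a generalizing a b
  · have := this (-a) (-b) (by linarith)
    rw [absRpowDeriv_neg, absRpowDeriv_neg, ← neg_sub', abs_neg] at this
    rwa [← neg_sub', abs_neg] at this
  rcases le_total 0 b with hb | hb
  · rw [absRpowDeriv_of_nonneg hq ha, absRpowDeriv_of_nonneg hq hb, ← mul_sub, abs_mul,
      abs_of_pos (by linarith : 0 < 1 + q)]
    have := abs_rpow_sub_rpow_le_s10 hq hq1 ha hb
    have h0 : 0 ≤ |a ^ q - b ^ q| := abs_nonneg _
    nlinarith
  · obtain ⟨c, rfl⟩ : ∃ c, b = -c := ⟨-b, by ring⟩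
    have hc : 0 ≤ c := by linarith
    rw [absRpowDeriv_neg, absRpowDeriv_of_nonneg hq ha, absRpowDeriv_of_nonneg hq hc,
      sub_neg_eq_add, sub_neg_eq_add, ← mul_add, abs_of_nonneg (by positivity),
      abs_of_nonneg (by positivity : 0 ≤ a + c)]
    have h1 : a ^ q ≤ (a + c) ^ q := Real.rpow_le_rpow ha (by linarith) hq.le
    have h2 : c ^ q ≤ (a + c) ^ q := Real.rpow_le_rpow hc (by linarith) hq.le
    have h3 : 0 ≤ a ^ q := by positivity
    have h4 : 0 ≤ c ^ q := by positivity
    nlinarith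

theorem ConvexOn.hasDerivAt_mul_sub_le {S : Set ℝ} {f : ℝ → ℝ} (hf : ConvexOn ℝ S f) {a b f' : ℝ}
    (ha : a ∈ S) (hb : b ∈ S) (hd : HasDerivAt f f' a) : f' * (b - a) ≤ f b - f a := by
  rcases lt_trichotomy a b with h | rfl | h
  · have := hf.le_slope_of_hasDerivAt ha hb h hd
    rwa [slope_def_field, le_div_iff₀ (sub_pos.2 h)] at this
  · simp
  · have := hf.slope_le_of_hasDerivAt hb ha h hd
    rw [slope_def_field, div_le_iff₀ (sub_pos.2 h)] at this
    linarith

/-- The Bregman divergence of `s ↦ |s| ^ (1 + q)`. -/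
noncomputable def absRpowBregman (q a b : ℝ) : ℝ :=
  |b| ^ (1 + q) - |a| ^ (1 + q) - absRpowDeriv q a * (b - a)

theorem absRpowBregman_nonneg {q : ℝ} (hq : 0 < q) (a b : ℝ) : 0 ≤ absRpowBregman q a b := by
  have hc : ConvexOn ℝ Set.univ (fun s : ℝ => |s| ^ (1 + q)) := by
    refine ⟨convex_univ, fun x _ y _ s t hs ht hst => ?_⟩
    refine le_trans ?_ ((convexOn_rpow (p := 1 + q) (by linarith)).2 (abs_nonneg x) (abs_nonneg y)
      hs ht hst)
    refine Real.rpow_le_rpow (abs_nonneg _) ?_ (by linarith)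
    have h := abs_add_le (s * x) (t * y)
    rwa [abs_mul, abs_mul, abs_of_nonneg hs, abs_of_nonneg ht] at h
  have := hc.hasDerivAt_mul_sub_le (Set.mem_univ a) (Set.mem_univ b)
    (hasDerivAt_abs_rpow_one_add hq a)
  rw [absRpowBregman]
  linarith

theorem sq_le_absRpowBregman_mul_max {q a b : ℝ} (hq : 0 < q) (hq1 : q ≤ 1) (ha : 0 ≤ a)
    (hb : 0 ≤ b) :
    q * (1 + q) / 2 * (b - a) ^ 2 ≤ absRpowBregman q a b * max a b ^ (1 - q) := by
  set M := max a b with hM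
  have hM0 : 0 ≤ M := le_max_of_le_left ha
  rcases hM0.eq_or_lt with h0 | hMpos
  · have h1 : a = 0 := le_antisymm (h0 ▸ le_max_left a b) ha
    have h2 : b = 0 := le_antisymm (h0 ▸ le_max_right a b) hb
    subst h1 h2
    simp [absRpowBregman]
  set c := q * (1 + q) * M ^ (q - 1) with hc
  have hd : ∀ s, HasDerivAt (fun s : ℝ => |s| ^ (1 + q) - c / 2 * s ^ 2)
      (absRpowDeriv q s - c * s) s := by
    intro s
    refine ((hasDerivAt_abs_rpow_one_add hq s).sub
      ((hasDerivAt_pow 2 s).const_mul (c / 2))).congr_deriv ?_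
    simp; ring
  have hconv : ConvexOn ℝ (Set.Icc 0 M) (fun s : ℝ => |s| ^ (1 + q) - c / 2 * s ^ 2) := by
    refine MonotoneOn.convexOn_of_deriv (convex_Icc 0 M)
      (fun s _ => (hd s).continuousAt.continuousWithinAt)
      (fun s _ => (hd s).differentiableAt.differentiableWithinAt) ?_
    intro s hs t ht hst
    rw [interior_Icc] at hs ht
    rw [(hd s).deriv, (hd t).deriv, absRpowDeriv_of_nonneg hq hs.1.le,
      absRpowDeriv_of_nonneg hq ht.1.le]
    have hMt : M ^ (q - 1) ≤ t ^ (q - 1) :=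
      Real.rpow_le_rpow_of_nonpos ht.1 ht.2.le (by linarith)
    have hamgm := Real.geom_mean_le_arith_mean2_weighted hq.le (sub_nonneg.2 hq1) hs.1.le ht.1.le
      (by ring)
    have hmul := mul_le_mul_of_nonneg_right hamgm (Real.rpow_nonneg ht.1.le (q - 1))
    have e1 : t ^ (1 - q) * t ^ (q - 1) = 1 := by rw [← Real.rpow_add ht.1]; simp
    have e2 : t * t ^ (q - 1) = t ^ q := by rw [mul_comm, ← Real.rpow_add_one ht.1.ne']; simp
    rw [mul_assoc, e1, mul_one] at hmul
    have htan : q * t ^ (q - 1) * (t - s) ≤ t ^ q - s ^ q := by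
      linear_combination hmul + e2
    have hle : c * (t - s) ≤ (1 + q) * (q * t ^ (q - 1) * (t - s)) := by
      have : 0 ≤ q * (1 + q) * (t - s) := by
        have := sub_nonneg.2 hst
        positivity
      have := mul_le_mul_of_nonneg_left hMt this
      rw [hc]
      linarith
    have := mul_le_mul_of_nonneg_left htan (by linarith : 0 ≤ 1 + q)
    linarith
  have h := hconv.hasDerivAt_mul_sub_le (a := a) (b := b) ⟨ha, le_max_left a b⟩
    ⟨hb, le_max_right a b⟩ (hd a)
  have h2 : c / 2 * (b - a) ^ 2 ≤ absRpowBregman q a b := by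
    rw [absRpowBregman]; nlinarith
  have h3 : M ^ (q - 1) * M ^ (1 - q) = 1 := by
    rw [← Real.rpow_add hMpos]; simp
  calc q * (1 + q) / 2 * (b - a) ^ 2
      = c / 2 * (b - a) ^ 2 * M ^ (1 - q) := by
        rw [hc]; linear_combination (-(q * (1 + q) / 2 * (b - a) ^ 2)) * h3
    _ ≤ _ := by gcongr

section Spectral

variable {n : Type*} [Fintype n] [DecidableEq n]

theorem trace_conj_diagonal_mul (P R U : Matrix n n ℝ) (hR : R * Rᵀ = 1) (a : n → ℝ) :
    (P * diagonal a * Pᵀ * U).trace = ∑ i, ∑ j, a i * (Pᵀ * R) i j * (Pᵀ * U * R) i j := by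
  have h : (P * diagonal a * Pᵀ * U).trace
      = (diagonal a * ((Pᵀ * U * R) * (Pᵀ * R)ᵀ)).trace := by
    have e : (Pᵀ * U * R) * (Pᵀ * R)ᵀ = Pᵀ * U * P := by
      rw [transpose_mul, transpose_transpose, Matrix.mul_assoc (Pᵀ * U), ← Matrix.mul_assoc R, hR,
        Matrix.one_mul]
    rw [e, Matrix.mul_assoc, Matrix.mul_assoc P, trace_mul_comm, Matrix.mul_assoc]
  rw [h, trace]
  refine Finset.sum_congr rfl fun i _ => ?_
  rw [diag_apply, diagonal_mul, mul_apply, Finset.mul_sum]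
  refine Finset.sum_congr rfl fun j _ => ?_
  rw [transpose_apply]
  ring

theorem trace_conj_diagonal_mul' (P R U : Matrix n n ℝ) (hP : P * Pᵀ = 1) (b : n → ℝ) :
    (R * diagonal b * Rᵀ * U).trace = ∑ i, ∑ j, b j * (Pᵀ * R) i j * (Pᵀ * U * R) i j := by
  have h : (R * diagonal b * Rᵀ * U).trace
      = (diagonal b * ((Pᵀ * R)ᵀ * (Pᵀ * U * R))).trace := by
    have e : (Pᵀ * R)ᵀ * (Pᵀ * U * R) = Rᵀ * U * R := by
      rw [transpose_mul, transpose_transpose, Matrix.mul_assoc Rᵀ, Matrix.mul_assoc Pᵀ,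
        ← Matrix.mul_assoc P, hP, Matrix.one_mul, ← Matrix.mul_assoc]
    rw [e, Matrix.mul_assoc, Matrix.mul_assoc R, trace_mul_comm, Matrix.mul_assoc]
  rw [h, trace, Finset.sum_comm]
  refine Finset.sum_congr rfl fun j _ => ?_
  rw [diag_apply, diagonal_mul, mul_apply, Finset.mul_sum]
  refine Finset.sum_congr rfl fun i _ => ?_
  rw [transpose_apply]
  ring

theorem sum_sq_row {O : Matrix n n ℝ} (hO : O * Oᵀ = 1) (i : n) : ∑ j, O i j ^ 2 = 1 := by
  have := congrFun (congrFun hO i) i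
  rw [mul_apply, one_apply_eq] at this
  simpa [sq] using this

theorem sum_sq_col {O : Matrix n n ℝ} (hO : Oᵀ * O = 1) (j : n) : ∑ i, O i j ^ 2 = 1 := by
  have := congrFun (congrFun hO j) j
  rw [mul_apply, one_apply_eq] at this
  simpa [sq] using this

theorem sum_sum_sq_mul_left_s10 {O : Matrix n n ℝ} (hO : O * Oᵀ = 1) (f : n → ℝ) :
    ∑ i, ∑ j, O i j ^ 2 * f i = ∑ i, f i :=
  Finset.sum_congr rfl fun i _ => by rw [← Finset.sum_mul, sum_sq_row hO, one_mul]

theorem sum_sum_sq_mul_right_s10 {O : Matrix n n ℝ} (hO : Oᵀ * O = 1) (f : n → ℝ) :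
    ∑ i, ∑ j, O i j ^ 2 * f j = ∑ j, f j := by
  rw [Finset.sum_comm]
  exact Finset.sum_congr rfl fun i _ => by rw [← Finset.sum_mul, sum_sq_col hO, one_mul]

theorem orthogonal_transpose_mul {P R : Matrix n n ℝ} (hP : P * Pᵀ = 1) (hR : Rᵀ * R = 1) :
    (Pᵀ * R)ᵀ * (Pᵀ * R) = 1 := by
  rw [transpose_mul, transpose_transpose, Matrix.mul_assoc, ← Matrix.mul_assoc P, hP,
    Matrix.one_mul, hR]

theorem trace_conj_mul_conj {P R : Matrix n n ℝ} (hR : Rᵀ * R = 1) (a b : n → ℝ) :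
    (P * diagonal a * Pᵀ * (R * diagonal b * Rᵀ)).trace
      = ∑ i, ∑ j, (Pᵀ * R) i j ^ 2 * (a i * b j) := by
  rw [trace_conj_diagonal_mul P R _ (mul_eq_one_comm.1 hR)]
  have e : Pᵀ * (R * diagonal b * Rᵀ) * R = Pᵀ * R * diagonal b := by
    rw [Matrix.mul_assoc, Matrix.mul_assoc _ Rᵀ, hR, Matrix.mul_one, ← Matrix.mul_assoc]
  rw [e]
  refine Finset.sum_congr rfl fun i _ => Finset.sum_congr rfl fun j _ => ?_
  rw [mul_diagonal]
  ring

theorem trace_conj_mul_self {P : Matrix n n ℝ} (hP : Pᵀ * P = 1) (a c : n → ℝ) :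
    (P * diagonal a * Pᵀ * (P * diagonal c * Pᵀ)).trace = ∑ i, a i * c i := by
  rw [trace_conj_mul_conj hP, hP]
  refine Finset.sum_congr rfl fun i _ => ?_
  rw [Finset.sum_eq_single i]
  · simp
  · intro j _ hj
    simp [one_apply_ne hj.symm]
  · simp

theorem sum_bregman_eq {P R : Matrix n n ℝ} (hP : Pᵀ * P = 1) (hR : Rᵀ * R = 1) (a b : n → ℝ)
    (f g : ℝ → ℝ) :
    ∑ j, f (b j) - ∑ i, f (a i)
        - (P * diagonal (g ∘ a) * Pᵀ * (R * diagonal b * Rᵀ - P * diagonal a * Pᵀ)).trace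
      = ∑ i, ∑ j, (Pᵀ * R) i j ^ 2 * (f (b j) - f (a i) - g (a i) * (b j - a i)) := by
  have hO := orthogonal_transpose_mul (mul_eq_one_comm.1 hP) hR
  rw [Matrix.mul_sub, trace_sub, trace_conj_mul_conj hR, trace_conj_mul_self hP,
    ← sum_sum_sq_mul_left_s10 (mul_eq_one_comm.1 hO) fun i => f (a i),
    ← sum_sum_sq_mul_right_s10 hO fun j => f (b j),
    ← sum_sum_sq_mul_left_s10 (mul_eq_one_comm.1 hO) fun i => (g ∘ a) i * a i]
  simp only [← Finset.sum_sub_distrib]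
  refine Finset.sum_congr rfl fun i _ => Finset.sum_congr rfl fun j _ => ?_
  simp only [Function.comp]
  ring

theorem trace_sub_sq_eq {P R : Matrix n n ℝ} (hP : Pᵀ * P = 1) (hR : Rᵀ * R = 1) (a b : n → ℝ) :
    ((R * diagonal b * Rᵀ - P * diagonal a * Pᵀ)
        * (R * diagonal b * Rᵀ - P * diagonal a * Pᵀ)).trace
      = ∑ i, ∑ j, (Pᵀ * R) i j ^ 2 * (b j - a i) ^ 2 := by
  have hO := orthogonal_transpose_mul (mul_eq_one_comm.1 hP) hR
  rw [Matrix.mul_sub, Matrix.sub_mul, Matrix.sub_mul, trace_sub, trace_sub, trace_sub,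
    trace_mul_comm (R * diagonal b * Rᵀ) (P * diagonal a * Pᵀ), trace_conj_mul_self hP,
    trace_conj_mul_self hR, trace_conj_mul_conj hR,
    ← sum_sum_sq_mul_left_s10 (mul_eq_one_comm.1 hO) fun i => a i * a i,
    ← sum_sum_sq_mul_right_s10 hO fun j => b j * b j]
  simp only [← Finset.sum_sub_distrib]
  refine Finset.sum_congr rfl fun i _ => Finset.sum_congr rfl fun j _ => ?_
  ring

/-- The functional calculus of a real symmetric matrix, with junk value `0` elsewhere. -/
noncomputable def spectralMap (f : ℝ → ℝ) (x : Matrix n n ℝ) : Matrix n n ℝ :=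
  open scoped Classical in
  if h : x.IsHermitian then
    (h.eigenvectorUnitary : Matrix n n ℝ) * diagonal (f ∘ h.eigenvalues)
      * (h.eigenvectorUnitary : Matrix n n ℝ)ᵀ
  else 0

theorem Matrix.IsHermitian.exists_orthogonal {x : Matrix n n ℝ} (hx : x.IsHermitian) :
    ∃ P : Matrix n n ℝ, Pᵀ * P = 1 ∧ x = P * diagonal hx.eigenvalues * Pᵀ ∧
      ∀ f, spectralMap f x = P * diagonal (f ∘ hx.eigenvalues) * Pᵀ := by
  refine ⟨hx.eigenvectorUnitary, ?_, ?_, fun f => ?_⟩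
  · have := Unitary.star_mul_self_of_mem hx.eigenvectorUnitary.2
    rwa [star_eq_conjTranspose, conjTranspose_eq_transpose_of_trivial] at this
  · have := hx.spectral_theorem
    rw [Unitary.conjStarAlgAut_apply, star_eq_conjTranspose,
      conjTranspose_eq_transpose_of_trivial] at this
    exact this
  · rw [spectralMap, dif_pos hx]

theorem conj_diagonal_isHermitian (P : Matrix n n ℝ) (a : n → ℝ) :
    (P * diagonal a * Pᵀ).IsHermitian := by
  simp [IsHermitian, conjTranspose_eq_transpose_of_trivial, Matrix.mul_assoc]

theorem spectralMap_isHermitian (f : ℝ → ℝ) (x : Matrix n n ℝ) : (spectralMap f x).IsHermitian := by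
  rw [spectralMap]
  split_ifs
  · exact conj_diagonal_isHermitian _ _
  · exact isHermitian_zero

omit [DecidableEq n] in
theorem frobenius_norm_sq (A : Matrix n n ℝ) : ‖A‖ ^ 2 = ∑ i, ∑ j, A i j ^ 2 := by
  rw [frobenius_norm_def, ← Real.sqrt_eq_rpow, Real.sq_sqrt (by positivity)]
  simp

omit [DecidableEq n] in
theorem Matrix.IsHermitian.frobenius_norm_sq_eq_trace_s10 {A : Matrix n n ℝ} (hA : A.IsHermitian) :
    ‖A‖ ^ 2 = (A * A).trace := by
  rw [frobenius_norm_sq, trace]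
  refine Finset.sum_congr rfl fun i _ => ?_
  rw [diag_apply, mul_apply]
  refine Finset.sum_congr rfl fun j _ => ?_
  rw [sq]
  congr 1
  have := hA.apply j i
  simpa using this

omit [DecidableEq n] in
theorem abs_trace_mul_le (A B : Matrix n n ℝ) : |(A * B).trace| ≤ ‖A‖ * ‖B‖ := by
  refine abs_le_of_sq_le_sq ?_ (by positivity)
  rw [mul_pow, frobenius_norm_sq, frobenius_norm_sq, Finset.sum_comm (f := fun i j => B i j ^ 2)]
  simp only [trace, diag_apply, mul_apply, ← Finset.sum_product']
  exact Finset.sum_mul_sq_le_sq_mul_sq _ (fun p : n × n => A p.1 p.2) (fun p => B p.2 p.1)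

theorem norm_spectralMap_sub_le {q : ℝ} (hq : 0 < q) (hq1 : q ≤ 1) {x y : Matrix n n ℝ}
    (hx : x.IsHermitian) (hy : y.IsHermitian) :
    ‖spectralMap (absRpowDeriv q) y - spectralMap (absRpowDeriv q) x‖
      ≤ 4 * Fintype.card n * ‖y - x‖ ^ q := by
  obtain ⟨P, hP, hxP, hfP⟩ := hx.exists_orthogonal
  obtain ⟨R, hR, hyR, hfR⟩ := hy.exists_orthogonal
  set a := hx.eigenvalues
  set b := hy.eigenvalues
  have hO := orthogonal_transpose_mul (mul_eq_one_comm.1 hP) hR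
  have hN : ‖y - x‖ ^ 2 = ∑ i, ∑ j, (Pᵀ * R) i j ^ 2 * (b j - a i) ^ 2 := by
    rw [(hy.sub hx).frobenius_norm_sq_eq_trace_s10, hxP, hyR, trace_sub_sq_eq hP hR]
  refine le_of_sq_le_sq ?_ (by positivity)
  rw [((spectralMap_isHermitian _ y).sub (spectralMap_isHermitian _ x)).frobenius_norm_sq_eq_trace_s10,
    hfP, hfR, trace_sub_sq_eq hP hR]
  have hterm : ∀ i j, (Pᵀ * R) i j ^ 2 * ((absRpowDeriv q ∘ b) j - (absRpowDeriv q ∘ a) i) ^ 2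
      ≤ 16 * (‖y - x‖ ^ q) ^ 2 := by
    intro i j
    set w := (Pᵀ * R) i j ^ 2 with hw
    have hw0 : 0 ≤ w := sq_nonneg _
    have hw1 : w ≤ 1 := by
      rw [← sum_sq_col hO j]
      exact Finset.single_le_sum (f := fun i => (Pᵀ * R) i j ^ 2) (fun _ _ => sq_nonneg _)
        (Finset.mem_univ i)
    have h1 : w * (b j - a i) ^ 2 ≤ ‖y - x‖ ^ 2 := by
      rw [hN]
      refine le_trans ?_ (Finset.single_le_sum
        (f := fun i => ∑ j, (Pᵀ * R) i j ^ 2 * (b j - a i) ^ 2)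
        (fun _ _ => Finset.sum_nonneg fun _ _ => by positivity) (Finset.mem_univ i))
      exact Finset.single_le_sum (f := fun j => (Pᵀ * R) i j ^ 2 * (b j - a i) ^ 2)
        (fun _ _ => by positivity) (Finset.mem_univ j)
    have h2 : w ≤ w ^ q := by
      simpa using Real.rpow_le_rpow_of_exponent_ge' hw0 hw1 hq.le hq1
    have h3 : (absRpowDeriv q (b j) - absRpowDeriv q (a i)) ^ 2 ≤ 16 * ((b j - a i) ^ 2) ^ q := by
      have := pow_le_pow_left₀ (abs_nonneg _) (abs_absRpowDeriv_sub_le hq hq1 (b j) (a i)) 2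
      rw [sq_abs, mul_pow, Real.rpow_pow_comm (abs_nonneg _), sq_abs] at this
      linarith
    calc w * (absRpowDeriv q (b j) - absRpowDeriv q (a i)) ^ 2
        ≤ w ^ q * (16 * ((b j - a i) ^ 2) ^ q) := by gcongr
      _ = 16 * (w * (b j - a i) ^ 2) ^ q := by
        rw [Real.mul_rpow hw0 (sq_nonneg _)]; ring
      _ ≤ 16 * (‖y - x‖ ^ 2) ^ q := by gcongr
      _ = _ := by rw [Real.rpow_pow_comm (norm_nonneg _)]
  calc _ ≤ ∑ _i : n, ∑ _j : n, 16 * (‖y - x‖ ^ q) ^ 2 :=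
        Finset.sum_le_sum fun i _ => Finset.sum_le_sum fun j _ => hterm i j
    _ = _ := by simp; ring

omit [DecidableEq n] in
theorem sum_rpow_one_sub_le {q k : ℝ} (hq : 0 < q) (hq1 : q ≤ 1) (hk : 0 < k) [Nonempty n]
    {a : n → ℝ} (ha : ∀ i, 0 ≤ a i) (hsum : ∑ i, a i = k) :
    ∑ i, a i ^ (1 - q) ≤ k * (Fintype.card n / k) ^ q := by
  have hm : (0 : ℝ) < Fintype.card n := by exact_mod_cast Fintype.card_pos
  set c : ℝ := k / Fintype.card n with hc
  have hc0 : 0 < c := by positivity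
  have hinv : (Fintype.card n / k : ℝ) = c⁻¹ := by rw [hc, inv_div]
  rw [hinv, Real.inv_rpow hc0.le, ← div_eq_mul_inv, le_div_iff₀ (by positivity), Finset.sum_mul]
  calc _ ≤ ∑ i, ((1 - q) * a i + q * c) := Finset.sum_le_sum fun i _ =>
        Real.geom_mean_le_arith_mean2_weighted (sub_nonneg.2 hq1) hq.le (ha i) hc0.le (by ring)
    _ = k := by
      rw [Finset.sum_add_distrib, ← Finset.mul_sum, hsum]
      simp only [Finset.sum_const, Finset.card_univ, nsmul_eq_mul, hc]
      field_simp
      ring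

/-- The Bregman divergence of `x ↦ ∑ |λ_j(x)| ^ (1 + q)` is an average of scalar Bregman divergences
of eigenvalues, weighted by the squared overlaps of the eigenbases. -/
theorem exists_bregman_representation {q : ℝ} {x y : Matrix n n ℝ} (hx : x.IsHermitian)
    (hy : y.IsHermitian) : ∃ P R : Matrix n n ℝ, P * Pᵀ = 1 ∧ R * Rᵀ = 1 ∧
      x = P * diagonal hx.eigenvalues * Pᵀ ∧ y = R * diagonal hy.eigenvalues * Rᵀ ∧
      ∑ j, |hy.eigenvalues j| ^ (1 + q) - ∑ i, |hx.eigenvalues i| ^ (1 + q)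
        - (spectralMap (absRpowDeriv q) x * (y - x)).trace
      = ∑ i, ∑ j, (Pᵀ * R) i j ^ 2 * absRpowBregman q (hx.eigenvalues i) (hy.eigenvalues j) := by
  obtain ⟨P, hP, hxP, hfP⟩ := hx.exists_orthogonal
  obtain ⟨R, hR, hyR, -⟩ := hy.exists_orthogonal
  refine ⟨P, R, mul_eq_one_comm.1 hP, mul_eq_one_comm.1 hR, hxP, hyR, ?_⟩
  have h := sum_bregman_eq hP hR hx.eigenvalues hy.eigenvalues (fun s => |s| ^ (1 + q))
    (absRpowDeriv q)
  rw [← hxP, ← hyR, ← hfP] at h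
  exact h

theorem trace_spectralMap_mul_sub_le {q : ℝ} (hq : 0 < q) {x y : Matrix n n ℝ} (hx : x.IsHermitian)
    (hy : y.IsHermitian) :
    (spectralMap (absRpowDeriv q) x * (y - x)).trace
      ≤ ∑ j, |hy.eigenvalues j| ^ (1 + q) - ∑ i, |hx.eigenvalues i| ^ (1 + q) := by
  obtain ⟨P, R, -, -, -, -, h⟩ := exists_bregman_representation (q := q) hx hy
  have : 0 ≤ ∑ i, ∑ j, (Pᵀ * R) i j ^ 2
      * absRpowBregman q (hx.eigenvalues i) (hy.eigenvalues j) :=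
    Finset.sum_nonneg fun i _ => Finset.sum_nonneg fun j _ =>
      mul_nonneg (sq_nonneg _) (absRpowBregman_nonneg hq _ _)
  linarith

theorem sum_eigenvalues_sq_le_bregman {q : ℝ} (hq : 0 < q) (hq1 : q ≤ 1) {x y : Matrix n n ℝ}
    (hx : x.IsHermitian) (hy : y.IsHermitian)
    (hx0 : ∀ i, 0 ≤ hx.eigenvalues i) (hy0 : ∀ i, 0 ≤ hy.eigenvalues i)
    (hx1 : ∀ i, hx.eigenvalues i ≤ 1) (hy1 : ∀ i, hy.eigenvalues i ≤ 1)
    (hh : (y - x).IsHermitian) :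
    q * (1 + q) / 2 * ∑ i, hh.eigenvalues i ^ 2
      ≤ ∑ j, |hy.eigenvalues j| ^ (1 + q) - ∑ i, |hx.eigenvalues i| ^ (1 + q)
        - (spectralMap (absRpowDeriv q) x * (y - x)).trace := by
  obtain ⟨P, R, hP, hR, hxP, hyR, h⟩ := exists_bregman_representation (q := q) hx hy
  obtain ⟨Q, hQ, hhQ, -⟩ := hh.exists_orthogonal
  have e1 : ((y - x) * (y - x)).trace = ∑ i, hh.eigenvalues i ^ 2 := by
    conv_lhs => rw [hhQ]
    rw [trace_conj_mul_self hQ]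
    simp only [sq]
  have e2 : ((y - x) * (y - x)).trace = ∑ i, ∑ j, (Pᵀ * R) i j ^ 2
      * (hy.eigenvalues j - hx.eigenvalues i) ^ 2 := by
    rw [← trace_sub_sq_eq (mul_eq_one_comm.1 hP) (mul_eq_one_comm.1 hR), ← hxP, ← hyR]
  rw [h, ← e1, e2]
  simp only [Finset.mul_sum]
  refine Finset.sum_le_sum fun i _ => Finset.sum_le_sum fun j _ => ?_
  rw [mul_left_comm]
  refine mul_le_mul_of_nonneg_left ?_ (sq_nonneg _)
  refine (sq_le_absRpowBregman_mul_max hq hq1 (hx0 i) (hy0 j)).trans ?_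
  exact mul_le_of_le_one_right (absRpowBregman_nonneg hq _ _)
    (Real.rpow_le_one (le_max_of_le_left (hx0 i)) (max_le (hx1 i) (hy1 j)) (sub_nonneg.2 hq1))

theorem sq_sum_abs_eigenvalues_le_bregman {q k : ℝ} (hq : 0 < q) (hq1 : q ≤ 1) (hk : 0 < k)
    [Nonempty n] {x y : Matrix n n ℝ} (hx : x.IsHermitian) (hy : y.IsHermitian)
    (hx0 : ∀ i, 0 ≤ hx.eigenvalues i) (hy0 : ∀ i, 0 ≤ hy.eigenvalues i)
    (hxk : ∑ i, hx.eigenvalues i = k) (hyk : ∑ i, hy.eigenvalues i = k)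
    (hh : (y - x).IsHermitian) :
    q * (1 + q) * (∑ i, |hh.eigenvalues i|) ^ 2
      ≤ 4 * (k * (Fintype.card n / k) ^ q)
        * (∑ j, |hy.eigenvalues j| ^ (1 + q) - ∑ i, |hx.eigenvalues i| ^ (1 + q)
          - (spectralMap (absRpowDeriv q) x * (y - x)).trace) := by
  obtain ⟨P, R, hP, hR, hxP, hyR, h⟩ := exists_bregman_representation (q := q) hx hy
  obtain ⟨Q, hQ, hhQ, -⟩ := hh.exists_orthogonal
  rw [h]
  set a := hx.eigenvalues
  set b := hy.eigenvalues
  set d := hh.eigenvalues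
  set s : n → ℝ := fun i => if 0 ≤ d i then 1 else -1 with hs
  have hs2 : ∀ i, s i * s i = 1 := fun i => by simp only [hs]; split_ifs <;> norm_num
  have hsd : ∀ i, d i * s i = |d i| := fun i => by
    simp only [hs]
    split_ifs with h0
    · rw [mul_one, abs_of_nonneg h0]
    · rw [mul_neg_one, abs_of_neg (not_le.1 h0)]
  set U := Q * diagonal s * Qᵀ with hU
  have hUU : Uᵀ * U = 1 := by
    have hUt : Uᵀ = U := by simp [hU, Matrix.mul_assoc]
    have e : U * U = Q * (diagonal s * (Qᵀ * Q) * diagonal s) * Qᵀ := by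
      rw [hU]; simp only [Matrix.mul_assoc]
    rw [hUt, e, hQ, Matrix.mul_one, diagonal_mul_diagonal]
    simp only [hs2]
    rw [diagonal_one, Matrix.mul_one, mul_eq_one_comm.1 hQ]
  set O := Pᵀ * R
  set V := Pᵀ * U * R
  have hV : Vᵀ * V = 1 := by
    have := orthogonal_transpose_mul (P := P) (R := U * R) hP (by
      rw [transpose_mul, Matrix.mul_assoc, ← Matrix.mul_assoc Uᵀ, hUU, Matrix.one_mul,
        mul_eq_one_comm.1 hR])
    rwa [← Matrix.mul_assoc Pᵀ U R] at this
  have htr : ∑ i, |d i| = ∑ p : n × n, (b p.2 - a p.1) * O p.1 p.2 * V p.1 p.2 := by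
    have e1 : ((y - x) * U).trace = ∑ i, |d i| := by
      conv_lhs => rw [hhQ, hU]
      rw [trace_conj_mul_self hQ]
      exact Finset.sum_congr rfl fun i _ => hsd i
    have e2 := trace_conj_diagonal_mul P R U hR a
    have e3 := trace_conj_diagonal_mul' P R U hP b
    rw [← hxP] at e2
    rw [← hyR] at e3
    rw [← e1, Matrix.sub_mul, trace_sub, e2, e3, Fintype.sum_prod_type]
    simp only [← Finset.sum_sub_distrib, sub_mul]
    rfl
  have hcs := Finset.sum_sq_le_sum_mul_sum_of_sq_le_mul (Finset.univ : Finset (n × n))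
    (r := fun p => (b p.2 - a p.1) * O p.1 p.2 * V p.1 p.2)
    (f := fun p => 2 / (q * (1 + q)) * (O p.1 p.2 ^ 2 * absRpowBregman q (a p.1) (b p.2)))
    (g := fun p => V p.1 p.2 ^ 2 * (a p.1 ^ (1 - q) + b p.2 ^ (1 - q)))
    (fun p _ => mul_nonneg (by positivity)
      (mul_nonneg (sq_nonneg _) (absRpowBregman_nonneg hq _ _)))
    (fun p _ => mul_nonneg (sq_nonneg _)
      (add_nonneg (Real.rpow_nonneg (hx0 _) _) (Real.rpow_nonneg (hy0 _) _)))
    (fun p _ => by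
      have h1 := sq_le_absRpowBregman_mul_max hq hq1 (hx0 p.1) (hy0 p.2)
      have h2 : max (a p.1) (b p.2) ^ (1 - q) ≤ a p.1 ^ (1 - q) + b p.2 ^ (1 - q) := by
        have h3 := Real.rpow_nonneg (hx0 p.1) (1 - q)
        have h4 := Real.rpow_nonneg (hy0 p.2) (1 - q)
        rcases max_choice (a p.1) (b p.2) with h5 | h5 <;> rw [h5] <;> linarith
      have h3 := h1.trans (mul_le_mul_of_nonneg_left h2 (absRpowBregman_nonneg hq _ _))
      have h4 := mul_le_mul_of_nonneg_left h3
        (by positivity : 0 ≤ 2 / (q * (1 + q)) * (O p.1 p.2 ^ 2 * V p.1 p.2 ^ 2))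
      have h5 : 2 / (q * (1 + q)) * (q * (1 + q) / 2) = 1 := by field_simp
      calc _ = 2 / (q * (1 + q)) * (q * (1 + q) / 2)
            * ((b p.2 - a p.1) * O p.1 p.2 * V p.1 p.2) ^ 2 := by rw [h5, one_mul]
        _ = 2 / (q * (1 + q)) * (O p.1 p.2 ^ 2 * V p.1 p.2 ^ 2)
            * (q * (1 + q) / 2 * (b p.2 - a p.1) ^ 2) := by ring
        _ ≤ _ := h4
        _ = _ := by ring)
  rw [← htr, ← Finset.mul_sum, Fintype.sum_prod_type, Fintype.sum_prod_type] at hcs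
  have hg : ∑ i, ∑ j, V i j ^ 2 * (a i ^ (1 - q) + b j ^ (1 - q))
      ≤ 2 * (k * (Fintype.card n / k) ^ q) := by
    simp only [mul_add, Finset.sum_add_distrib]
    rw [sum_sum_sq_mul_left_s10 (mul_eq_one_comm.1 hV) fun i => a i ^ (1 - q),
      sum_sum_sq_mul_right_s10 hV fun j => b j ^ (1 - q)]
    linarith [sum_rpow_one_sub_le hq hq1 hk hx0 hxk, sum_rpow_one_sub_le hq hq1 hk hy0 hyk]
  have hB : 0 ≤ ∑ i, ∑ j, O i j ^ 2 * absRpowBregman q (a i) (b j) :=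
    Finset.sum_nonneg fun i _ => Finset.sum_nonneg fun j _ =>
      mul_nonneg (sq_nonneg _) (absRpowBregman_nonneg hq _ _)
  have h6 := hcs.trans (mul_le_mul_of_nonneg_left hg (mul_nonneg (by positivity) hB))
  have h7 := mul_le_mul_of_nonneg_left h6 (by positivity : 0 ≤ q * (1 + q))
  refine h7.trans_eq ?_
  field_simp
  ring

/-- Symmetric matrices with eigenvalues in `[0, 1]` and trace `k`. -/
def spectralHypersimplex (n : Type*) [Fintype n] [DecidableEq n] (k : ℝ) : Set (Matrix n n ℝ) :=
  {x | x.IsHermitian ∧ x.PosSemidef ∧ ((1 : Matrix n n ℝ) - x).PosSemidef ∧ x.trace = k}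

theorem convex_spectralHypersimplex (k : ℝ) : Convex ℝ (spectralHypersimplex n k) := by
  rintro x ⟨hx1, hx2, hx3, hx4⟩ y ⟨hy1, hy2, hy3, hy4⟩ s t hs ht hst
  have h := (hx2.smul hs).add (hy2.smul ht)
  refine ⟨h.isHermitian, h, ?_, ?_⟩
  · have e : (1 : Matrix n n ℝ) - (s • x + t • y) = s • (1 - x) + t • (1 - y) := by
      rw [smul_sub, smul_sub, sub_add_sub_comm, ← add_smul, hst, one_smul]
    rw [e]
    exact (hx3.smul hs).add (hy3.smul ht)
  · rw [trace_add, trace_smul, trace_smul, hx4, hy4, ← add_smul, hst, one_smul]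

theorem conj_diagonal_mem_spectralHypersimplex {P : Matrix n n ℝ} (hP : Pᵀ * P = 1) {a : n → ℝ}
    {k : ℝ} (h0 : ∀ i, 0 ≤ a i) (h1 : ∀ i, a i ≤ 1) (hk : ∑ i, a i = k) :
    P * diagonal a * Pᵀ ∈ spectralHypersimplex n k := by
  have hpsd : ∀ c : n → ℝ, (∀ i, 0 ≤ c i) → (P * diagonal c * Pᵀ).PosSemidef := fun c hc => by
    have := (posSemidef_diagonal_iff.2 hc).mul_mul_conjTranspose_same P
    rwa [conjTranspose_eq_transpose_of_trivial] at this
  refine ⟨conj_diagonal_isHermitian P a, hpsd a h0, ?_, ?_⟩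
  · have e : (1 : Matrix n n ℝ) - P * diagonal a * Pᵀ = P * diagonal (fun i => 1 - a i) * Pᵀ := by
      rw [← diagonal_sub, diagonal_one, Matrix.mul_sub, Matrix.sub_mul, Matrix.mul_one,
        mul_eq_one_comm.1 hP]
    rw [e]
    exact hpsd _ fun i => sub_nonneg.2 (h1 i)
  · rw [trace_mul_comm, ← Matrix.mul_assoc, hP, Matrix.one_mul, trace_diagonal, hk]

theorem eigenvalues_le_one_of_mem {k : ℝ} {x : Matrix n n ℝ} (hx : x ∈ spectralHypersimplex n k)
    (i : n) : hx.1.eigenvalues i ≤ 1 := by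
  obtain ⟨P, hP, hxP, -⟩ := hx.1.exists_orthogonal
  have h := hx.2.2.1.conjTranspose_mul_mul_same P
  have e : Pᴴ * (1 - x) * P = 1 - diagonal hx.1.eigenvalues := by
    conv_lhs => rw [hxP]
    rw [conjTranspose_eq_transpose_of_trivial, Matrix.mul_sub, Matrix.sub_mul, Matrix.mul_one, hP]
    congr 1
    rw [Matrix.mul_assoc, Matrix.mul_assoc _ Pᵀ, hP, Matrix.mul_one, ← Matrix.mul_assoc, hP,
      Matrix.one_mul]
  rw [e] at h
  have := h.diag_nonneg (i := i)
  simpa using this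

theorem sum_eigenvalues_of_mem {k : ℝ} {x : Matrix n n ℝ} (hx : x ∈ spectralHypersimplex n k) :
    ∑ i, hx.1.eigenvalues i = k := by
  exact hx.1.trace_eq_sum_eigenvalues.symm.trans hx.2.2.2

theorem gauge_spectralHypersimplex_smul {k : ℝ} (c : ℝ) (h : Matrix n n ℝ) :
    gauge ((2⁻¹ : ℝ) • (spectralHypersimplex n k - spectralHypersimplex n k)) (c • h) ^ 2
      = c ^ 2 * gauge ((2⁻¹ : ℝ) • (spectralHypersimplex n k - spectralHypersimplex n k)) h ^ 2 := by
  have hsymm : ∀ x ∈ (2⁻¹ : ℝ) • (spectralHypersimplex n k - spectralHypersimplex n k),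
      -x ∈ (2⁻¹ : ℝ) • (spectralHypersimplex n k - spectralHypersimplex n k) := by
    rintro _ ⟨_, ⟨u, hu, v, hv, rfl⟩, rfl⟩
    exact ⟨v - u, ⟨v, hv, u, hu, rfl⟩, by simp [← smul_neg]⟩
  rcases le_total 0 c with hc | hc
  · rw [gauge_smul_of_nonneg hc, smul_eq_mul, mul_pow]
  · rw [← gauge_neg hsymm, ← neg_smul, gauge_smul_of_nonneg (neg_nonneg.2 hc), smul_eq_mul, mul_pow,
      neg_sq]

/-- A trace-free symmetric matrix with operator norm at most `1` and nuclear norm at most `2k` is a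
difference of two elements of the spectral hypersimplex. -/
theorem conj_diagonal_mem_sub {P : Matrix n n ℝ} (hP : Pᵀ * P = 1) {d : n → ℝ} {k : ℝ}
    (hk : 2 * k ≤ Fintype.card n) (hd : ∀ i, |d i| ≤ 1) (hsum : ∑ i, d i = 0)
    (habs : ∑ i, |d i| ≤ 2 * k) :
    P * diagonal d * Pᵀ ∈ spectralHypersimplex n k - spectralHypersimplex n k := by
  set S := ∑ i, |d i| with hS
  set m : ℝ := (Fintype.card n : ℝ) with hm
  set θ : ℝ := (k - S / 2) / (m - S) with hθ
  have hθ0 : 0 ≤ θ := div_nonneg (by linarith) (by linarith)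
  have hθm : θ * (m - S) = k - S / 2 := by
    rcases eq_or_ne (m - S) 0 with h0 | h0
    · rw [h0]; linarith
    · rw [hθ, div_mul_cancel₀ _ h0]
  have hθ1 : θ ≤ 1 := div_le_one_of_le₀ (by linarith) (by linarith)
  have key : ∀ e : n → ℝ, (∀ i, |e i| = |d i|) → ∑ i, e i = 0 →
      P * diagonal (fun i => (|d i| + e i) / 2 + θ * (1 - |d i|)) * Pᵀ
        ∈ spectralHypersimplex n k := by
    intro e he hes
    refine conj_diagonal_mem_spectralHypersimplex hP (fun i => ?_) (fun i => ?_) ?_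
    · have h1 := neg_abs_le (e i)
      rw [he] at h1
      have := mul_nonneg hθ0 (sub_nonneg.2 (hd i))
      linarith
    · have h1 := le_abs_self (e i)
      rw [he] at h1
      have := mul_le_mul_of_nonneg_right hθ1 (sub_nonneg.2 (hd i))
      linarith
    · rw [Finset.sum_add_distrib, ← Finset.sum_div, ← Finset.mul_sum, Finset.sum_add_distrib, hes,
        Finset.sum_sub_distrib]
      simp only [Finset.sum_const, Finset.card_univ, nsmul_eq_mul, mul_one]
      rw [← hS, ← hm, hθm]
      ring
  refine ⟨_, key d (fun _ => rfl) hsum, _, key (fun i => -d i) (fun i => abs_neg _) (by simp [hsum]),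
    ?_⟩
  simp only
  rw [← Matrix.sub_mul, ← Matrix.mul_sub, diagonal_sub]
  congr 3
  ext i
  ring

theorem gauge_sq_le {h : Matrix n n ℝ} (hh : h.IsHermitian) (htr : h.trace = 0) {k Q : ℝ}
    (hk0 : 0 < k) (hk : 2 * k ≤ Fintype.card n) (hop : ∀ i, (2 * hh.eigenvalues i) ^ 2 ≤ Q)
    (hnuc : (∑ i, |hh.eigenvalues i|) ^ 2 ≤ k ^ 2 * Q) :
    gauge ((2⁻¹ : ℝ) • (spectralHypersimplex n k - spectralHypersimplex n k)) h ^ 2 ≤ Q := by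
  obtain ⟨P, hP, hhP, -⟩ := hh.exists_orthogonal
  set d := hh.eigenvalues with hd
  have hQ0 : 0 ≤ Q := by
    have := (sq_nonneg _).trans hnuc
    exact nonneg_of_mul_nonneg_right this (by positivity)
  rcases hQ0.eq_or_lt with rfl | hQ
  · have hz : d = 0 := by
      ext i
      have := le_antisymm (hop i) (sq_nonneg _)
      simpa using this
    rw [hhP, hz]
    simp
  set r := √Q with hr
  have hr0 : 0 < r := Real.sqrt_pos.2 hQ
  have hr2 : r ^ 2 = Q := Real.sq_sqrt hQ0
  rw [← hr2]
  refine pow_le_pow_left₀ (gauge_nonneg _) (gauge_le_of_mem hr0.le ?_) 2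
  have hsum : ∑ i, d i = 0 := by
    rw [← htr, hh.trace_eq_sum_eigenvalues]
    rfl
  have hmem := conj_diagonal_mem_sub (k := k) hP (d := fun i => 2 / r * d i) hk
    (fun i => by
      have h1 : |2 * d i| ≤ r := abs_le_of_sq_le_sq (by rw [hr2]; exact hop i) hr0.le
      rw [div_mul_eq_mul_div, abs_div, abs_of_pos hr0]
      exact div_le_one_of_le₀ h1 hr0.le)
    (by rw [← Finset.mul_sum, hsum, mul_zero])
    (by
      have h1 : ∑ i, |d i| ≤ k * r := by
        refine le_of_sq_le_sq ?_ (by positivity)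
        rw [mul_pow, hr2]
        exact hnuc
      simp only [abs_mul]
      rw [← Finset.mul_sum, abs_of_pos (by positivity), div_mul_eq_mul_div, div_le_iff₀ hr0]
      linarith)
  refine ⟨_, ⟨_, hmem, rfl⟩, ?_⟩
  have e : (fun i => 2 / r * d i) = (2 / r) • d := rfl
  simp only
  rw [e, diagonal_smul, Matrix.mul_smul, Matrix.smul_mul, ← hhP, smul_smul, smul_smul]
  have : r * (2⁻¹ * (2 / r)) = 1 := by field_simp
  rw [mul_assoc, this, one_smul]

end Spectral

/-- The numerical relations between the exponent `q` and the constant `β`. -/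
theorem exponent_bounds {m k : ℕ} (hm : 2 ≤ m) (hk1 : 1 ≤ k) (hk2 : 2 * k ≤ m) {q β : ℝ}
    (hq : q = if 1 < k then min 1 (Real.log k / Real.log ((m : ℝ) / k)) else 1 / (2 * Real.log m))
    (hβ : β = if Real.sqrt m ≤ (k : ℝ) then 1
      else if 1 < k then q / 2 else q / (2 * Real.sqrt (Real.exp 1))) :
    0 < q ∧ q ≤ 1 ∧ 0 < β ∧ β ≤ q ∧ β * ((m : ℝ) / k) ^ q ≤ 2 * q * k := by
  have hm' : (2 : ℝ) ≤ m := by exact_mod_cast hm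
  have hk1' : (1 : ℝ) ≤ k := by exact_mod_cast hk1
  have hk2' : 2 * (k : ℝ) ≤ m := by exact_mod_cast hk2
  have hk0 : (0 : ℝ) < k := by linarith
  have hmk : 2 ≤ (m : ℝ) / k := by rwa [le_div_iff₀ hk0]
  have hlmk : 0 < Real.log ((m : ℝ) / k) := Real.log_pos (by linarith)
  by_cases h1 : 1 < k
  · rw [if_pos h1] at hq
    have h1' : (1 : ℝ) < k := by exact_mod_cast h1
    have hlk : 0 < Real.log k := Real.log_pos h1'
    have hq0 : 0 < q := hq ▸ lt_min one_pos (div_pos hlk hlmk)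
    have hq1 : q ≤ 1 := hq ▸ min_le_left _ _
    have hqlog : q * Real.log ((m : ℝ) / k) ≤ Real.log k := by
      rw [← le_div_iff₀ hlmk, hq]
      exact min_le_right _ _
    have hK : ((m : ℝ) / k) ^ q ≤ k := by
      rw [Real.rpow_def_of_pos (by linarith), ← Real.le_log_iff_exp_le hk0, mul_comm]
      exact hqlog
    have hβq : 0 < β ∧ β ≤ q := by
      by_cases h2 : Real.sqrt m ≤ (k : ℝ)
      · rw [if_pos h2] at hβ
        have h3 : (m : ℝ) / k ≤ k := by
          rw [div_le_iff₀ hk0, ← sq]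
          exact (Real.sqrt_le_left hk0.le).1 h2
        have h4 : q = 1 := by
          rw [hq, min_eq_left]
          rw [le_div_iff₀ hlmk, one_mul]
          exact Real.log_le_log (by linarith) h3
        rw [hβ, h4]
        norm_num
      · rw [if_neg h2, if_pos h1] at hβ
        constructor <;> linarith
    refine ⟨hq0, hq1, hβq.1, hβq.2, ?_⟩
    have := mul_le_mul hβq.2 hK (by positivity) hq0.le
    nlinarith [mul_pos hq0 hk0]
  · obtain rfl : k = 1 := by omega
    rw [if_neg h1] at hq
    have h2 : ¬ Real.sqrt m ≤ ((1 : ℕ) : ℝ) := by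
      rw [Real.sqrt_le_left (by simp)]
      push_cast
      linarith
    rw [if_neg h2, if_neg h1] at hβ
    have hlm : 1 / 2 < Real.log m := by
      have h3 := Real.log_le_log (by norm_num) hm'
      have h4 := Real.log_two_gt_d9
      linarith
    have hq0 : 0 < q := by rw [hq]; positivity
    have hq1 : q ≤ 1 := by rw [hq]; exact div_le_one_of_le₀ (by linarith) (by linarith)
    have hE1 : 1 ≤ Real.sqrt (Real.exp 1) := Real.one_le_sqrt.2 (Real.one_le_exp zero_le_one)
    have hK : ((m : ℝ) / (1 : ℕ)) ^ q = Real.sqrt (Real.exp 1) := by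
      rw [← Real.exp_half, Nat.cast_one, div_one, Real.rpow_def_of_pos (by linarith), hq]
      congr 1
      field_simp
    refine ⟨hq0, hq1, by rw [hβ]; positivity, ?_, ?_⟩
    · rw [hβ]
      exact div_le_self hq0.le (by linarith)
    · rw [hK, hβ]
      have : q / (2 * √(Real.exp 1)) * √(Real.exp 1) = q / 2 := by field_simp
      rw [this]
      push_cast
      linarith

/-- Let `m ≥ 2`, `1 ≤ k ≤ m/2`, `q`, `β` as specified,
`X = {x ∈ S^m : 0 ⪯ x ⪯ I, Tr(x) = k}`, and `ω(x) = (4/(β(1+q)))·Σ_j |λ_j(x)|^{1+q}`.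
Then `ω` is convex and continuously differentiable on `S^m`, strongly convex with modulus 1
on `X` w.r.t. the norm on `{Tr = 0}` whose unit ball is `½[X−X]` (its gauge), and
`Ω_X = √(2(max_X ω − min_X ω)) ≤ 2√(2k/(β(1+q)))`. -/
theorem stmt_10 (m k : ℕ) (hm : 2 ≤ m) (hk1 : 1 ≤ k) (hk2 : 2 * k ≤ m)
    (q β : ℝ)
    (hq : q = if 1 < k then min 1 (Real.log k / Real.log ((m : ℝ) / k)) else 1 / (2 * Real.log m))
    (hβ : β = if Real.sqrt m ≤ (k : ℝ) then 1
      else if 1 < k then q / 2 else q / (2 * Real.sqrt (Real.exp 1)))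
    (eig : Matrix (Fin m) (Fin m) ℝ → Fin m → ℝ)
    (heig : ∀ (y : Matrix (Fin m) (Fin m) ℝ) (h : y.IsHermitian), eig y = h.eigenvalues)
    (X : Set (Matrix (Fin m) (Fin m) ℝ))
    (hX : X = {x | x.IsHermitian ∧ x.PosSemidef ∧
      ((1 : Matrix (Fin m) (Fin m) ℝ) - x).PosSemidef ∧ x.trace = (k : ℝ)})
    (ω : Matrix (Fin m) (Fin m) ℝ → ℝ)
    (hω : ω = fun x => (4 / (β * (1 + q))) * ∑ j, |eig x j| ^ (1 + q))
    (NX : Matrix (Fin m) (Fin m) ℝ → ℝ)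
    (hNX : NX = gauge ((2⁻¹ : ℝ) • (X - X))) :
    ConvexOn ℝ {y : Matrix (Fin m) (Fin m) ℝ | y.IsHermitian} ω ∧
    ContDiffOn ℝ 1 ω {y | y.IsHermitian} ∧
    (∀ u ∈ X, ∀ v ∈ X, ∀ t ∈ Set.Icc (0 : ℝ) 1,
      ω (t • u + (1 - t) • v) ≤
        t * ω u + (1 - t) * ω v - (1 / 2) * t * (1 - t) * NX (u - v) ^ 2) ∧
    Real.sqrt (2 * (sSup (ω '' X) - sInf (ω '' X))) ≤
      2 * Real.sqrt (2 * k / (β * (1 + q))) := by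
  obtain ⟨hq0, hq1, hβ0, hβq, hβK⟩ := exponent_bounds hm hk1 hk2 hq hβ
  have hk0 : (0 : ℝ) < k := by exact_mod_cast hk1
  have : Nonempty (Fin m) := ⟨⟨0, by omega⟩⟩
  have hcard : (Fintype.card (Fin m) : ℝ) = m := by simp
  set c : ℝ := 4 / (β * (1 + q)) with hc
  have hc0 : 0 < c := by positivity
  have hωe : ∀ x (hx : x.IsHermitian), ω x = c * ∑ j, |hx.eigenvalues j| ^ (1 + q) := by
    intro x hx
    rw [hω]
    simp only
    rw [heig x hx]
  have hX' : X = spectralHypersimplex (Fin m) (k : ℝ) := hX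
  set L : Matrix (Fin m) (Fin m) ℝ → Matrix (Fin m) (Fin m) ℝ →ₗ[ℝ] ℝ := fun x =>
    c • (traceLinearMap (Fin m) ℝ ℝ ∘ₗ LinearMap.mulLeft ℝ (spectralMap (absRpowDeriv q) x))
  have hL : ∀ x h, L x h = c * (spectralMap (absRpowDeriv q) x * h).trace := fun x h => rfl
  have hsub : ∀ x ∈ {y : Matrix (Fin m) (Fin m) ℝ | y.IsHermitian},
      ∀ y ∈ {y : Matrix (Fin m) (Fin m) ℝ | y.IsHermitian}, L x (y - x) ≤ ω y - ω x := by
    intro x hx y hy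
    rw [hL, hωe x hx, hωe y hy, ← mul_sub]
    exact mul_le_mul_of_nonneg_left (trace_spectralMap_mul_sub_le hq0 hx hy) hc0.le
  have hconvS : Convex ℝ {y : Matrix (Fin m) (Fin m) ℝ | y.IsHermitian} := by
    intro x hx y hy s t _ _ _
    exact IsSelfAdjoint.add (hx.smul (IsSelfAdjoint.all s)) (hy.smul (IsSelfAdjoint.all t))
  refine ⟨⟨hconvS, ?_⟩, ?_, ?_, ?_⟩
  · intro x hx y hy s t hs ht hst
    obtain rfl : t = 1 - s := by linarith
    have := strongly_convex_of_subgradient hconvS ω L (fun _ => 0) (by simp)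
      (fun x hx y hy => by simpa using hsub x hx y hy) hx hy (t := s) ⟨hs, by linarith⟩
    simpa using this
  · let T : Matrix (Fin m) (Fin m) ℝ →ₗ[ℝ] Matrix (Fin m) (Fin m) ℝ :=
      (2⁻¹ : ℝ) • (LinearMap.id + (transposeLinearEquiv (Fin m) (Fin m) ℝ ℝ).toLinearMap)
    have hT : ∀ x, T x = (2⁻¹ : ℝ) • (x + xᵀ) := fun x => rfl
    refine contDiffOn_of_hoelder_subgradient T (fun x => ?_) (fun x hx => ?_) ω L
      (C := c * (4 * Fintype.card (Fin m))) hq0 hsub fun x hx y hy h => ?_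
    · rw [hT, Set.mem_ofPred_eq, IsHermitian, conjTranspose_eq_transpose_of_trivial]
      simp [add_comm]
    · have hx' : xᵀ = x := by
        have : x.IsHermitian := hx
        rwa [IsHermitian, conjTranspose_eq_transpose_of_trivial] at this
      rw [hT, hx', ← two_smul ℝ x, smul_smul]
      norm_num
    · rw [hL, hL, ← mul_sub, ← trace_sub, ← Matrix.sub_mul, abs_mul, abs_of_pos hc0, mul_assoc c,
        mul_assoc c]
      refine mul_le_mul_of_nonneg_left ((abs_trace_mul_le _ _).trans ?_) hc0.le
      exact mul_le_mul_of_nonneg_right (norm_spectralMap_sub_le hq0 hq1 hx hy) (norm_nonneg h)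
  · intro u hu v hv t ht
    rw [hX'] at hu hv
    refine strongly_convex_of_subgradient (convex_spectralHypersimplex (k : ℝ)) ω L NX
      (fun s h => ?_) (fun x hx y hy => ?_) hu hv ht
    · rw [hNX, hX']
      exact gauge_spectralHypersimplex_smul s h
    · have hh : (y - x).IsHermitian := hy.1.sub hx.1
      have hx0 := hx.2.1.eigenvalues_nonneg
      have hy0 := hy.2.1.eigenvalues_nonneg
      have h1 := sum_eigenvalues_sq_le_bregman hq0 hq1 hx.1 hy.1 hx0 hy0
        (eigenvalues_le_one_of_mem hx) (eigenvalues_le_one_of_mem hy) hh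
      have h2 := sq_sum_abs_eigenvalues_le_bregman hq0 hq1 hk0 hx.1 hy.1 hx0 hy0
        (sum_eigenvalues_of_mem hx) (sum_eigenvalues_of_mem hy) hh
      rw [hL, hωe x hx.1, hωe y hy.1]
      set D := ∑ j, |hy.1.eigenvalues j| ^ (1 + q) - ∑ i, |hx.1.eigenvalues i| ^ (1 + q)
        - (spectralMap (absRpowDeriv q) x * (y - x)).trace with hD
      have hsq0 : 0 ≤ ∑ i, hh.eigenvalues i ^ 2 := Finset.sum_nonneg fun _ _ => sq_nonneg _
      have hD0 : 0 ≤ D := le_trans (by positivity) h1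
      have hcβ : c * (β * (1 + q)) = 4 := by rw [hc]; field_simp
      have hcq : 4 ≤ c * (q * (1 + q)) := by
        rw [← hcβ]
        gcongr
      have hN : NX (y - x) ^ 2 ≤ 2 * c * D := by
        rw [hNX, hX']
        refine gauge_sq_le hh ?_ hk0 (by rw [hcard]; exact_mod_cast hk2) (fun i => ?_) ?_
        · rw [trace_sub, hx.2.2.2, hy.2.2.2, sub_self]
        · have h3 := Finset.single_le_sum (f := fun i => hh.eigenvalues i ^ 2)
            (fun _ _ => sq_nonneg _) (Finset.mem_univ i)
          have h4 := mul_le_mul_of_nonneg_left h1 hc0.le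
          have h5 := mul_le_mul_of_nonneg_right hcq hsq0
          linarith
        · rw [hcard] at h2
          have hA : 0 ≤ (∑ i, |hh.eigenvalues i|) ^ 2 := sq_nonneg _
          have h3 := mul_le_mul_of_nonneg_left h2 (by positivity : 0 ≤ c * β)
          have h4 := mul_le_mul_of_nonneg_left hβK (by positivity : 0 ≤ 4 * c * k * D)
          have h5 : 4 * q * (∑ i, |hh.eigenvalues i|) ^ 2 ≤ 4 * q * (k ^ 2 * (2 * c * D)) := by
            calc _ = c * β * (q * (1 + q) * (∑ i, |hh.eigenvalues i|) ^ 2) := by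
                  rw [← hcβ]; ring
              _ ≤ _ := h3
              _ = 4 * c * k * D * (β * ((m : ℝ) / k) ^ q) := by ring
              _ ≤ _ := h4
              _ = _ := by ring
          exact le_of_mul_le_mul_left h5 (by positivity)
      linarith
  · have hle : ∀ x ∈ X, ω x ≤ c * k := by
      intro x hx
      rw [hX'] at hx
      rw [hωe x hx.1]
      refine mul_le_mul_of_nonneg_left ((Finset.sum_le_sum fun i _ => ?_).trans_eq
        (sum_eigenvalues_of_mem hx)) hc0.le
      have h0 := hx.2.1.eigenvalues_nonneg i
      rw [abs_of_nonneg h0]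
      simpa using Real.rpow_le_rpow_of_exponent_ge' h0 (eigenvalues_le_one_of_mem hx i) zero_le_one
        (by linarith : 1 ≤ 1 + q)
    have hge : ∀ x ∈ X, 0 ≤ ω x := by
      intro x hx
      rw [hX'] at hx
      rw [hωe x hx.1]
      positivity
    have h1 : sSup (ω '' X) ≤ c * k :=
      Real.sSup_le (by rintro _ ⟨x, hx, rfl⟩; exact hle x hx) (by positivity)
    have h2 : 0 ≤ sInf (ω '' X) :=
      Real.sInf_nonneg (by rintro _ ⟨x, hx, rfl⟩; exact hge x hx)
    refine Real.sqrt_le_iff.2 ⟨by positivity, ?_⟩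
    rw [mul_pow, Real.sq_sqrt (by positivity)]
    have h3 : 2 ^ 2 * (2 * k / (β * (1 + q))) = 2 * (c * k) := by rw [hc]; ring
    rw [h3]
    linarith
end
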